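/- arXiv:0806.1353 — 6 statements merged into one kernel-verified Lean document; each statement's English description precedes it below -/
import Mathlib

section
/- Under Assumptions (A1)–(A3) and for any constant γ > 0, there exist a unique radius R_s > 0 and unique functions σ_s, v_s, p_s : [0,R_s] → ℝ, each continuous on [0,R_s] and twice continuously differentiable on (0,R_s], such that: (i) σ_s''(r) + (2/r)σ_s'(r) = f(σ_s(r)) and σ_s(r) ≥ 0 for 0 < r ≤ R_s, lim_{r→0⁺} σ_s'(r) = 0, and σ_s(R_s) = 1; (ii) v_s'(r) + (2/r)v_s(r) = g(σ_s(r)) for 0 < r ≤ R_s, v_s(0) = 0 and v_s(R_s) = 0; (iii) (d²/dr² + (2/r)(d/dr))(p_s(r) − (4/3)g(σ_s(r))) = 0 for 0 < r ≤ R_s, lim_{r→0⁺} p_s'(r) = 0, and p_s(R_s) = γ/R_s + (4/3)g(1). Moreover, the pressure is given explicitly by p_s(r) = γ/R_s + (4/3)g(σ_s(r)) for all r ∈ [0,R_s]. -/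
open Set Filter MeasureTheory

noncomputable section

/-- Assumption (A1): `f` is smooth on `[0,∞)`, `f(0) = 0` and `f' > 0` on `[0,∞)`. -/
def A1cond (f : ℝ → ℝ) : Prop :=
  ContDiffOn ℝ (⊤ : ℕ∞) f (Ici 0) ∧ f 0 = 0 ∧ ∀ σ : ℝ, 0 ≤ σ → 0 < deriv f σ

/-- Assumptions (A2)-(A3): `g` is smooth on `[0,∞)`, `g' > 0` on `[0,∞)` and
`g(σ_c) = 0` for some `0 < σ_c < 1`. -/
def A2A3cond (g : ℝ → ℝ) : Prop :=
  ContDiffOn ℝ (⊤ : ℕ∞) g (Ici 0) ∧ (∀ σ : ℝ, 0 ≤ σ → 0 < deriv g σ) ∧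
    ∃ σc : ℝ, 0 < σc ∧ σc < 1 ∧ g σc = 0

/-- The radially symmetric stationary nutrient concentration `σ_s` on `[0,1]`
(normalized radius `R_s = 1`): continuous on `[0,1]`, twice continuously
differentiable on `(0,1]`, solving `σ'' + (2/r)σ' = f(σ)` with `σ ≥ 0` on `(0,1]`,
`lim_{r→0⁺} σ'(r) = 0` and `σ(1) = 1`. -/
def SigmaS (f σs : ℝ → ℝ) : Prop :=
  ContinuousOn σs (Icc 0 1) ∧
  (∀ r ∈ Ioc (0:ℝ) 1, HasDerivAt σs (deriv σs r) r) ∧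
  (∀ r ∈ Ioc (0:ℝ) 1, HasDerivAt (deriv σs) (deriv (deriv σs) r) r) ∧
  ContinuousOn (deriv σs) (Ioc 0 1) ∧
  ContinuousOn (deriv (deriv σs)) (Ioc 0 1) ∧
  (∀ r ∈ Ioc (0:ℝ) 1, deriv (deriv σs) r + (2 / r) * deriv σs r = f (σs r)) ∧
  (∀ r ∈ Ioc (0:ℝ) 1, 0 ≤ σs r) ∧
  Tendsto (deriv σs) (nhdsWithin 0 (Ioi 0)) (nhds 0) ∧
  σs 1 = 1

/-- The mode-`l` radial function `F_l`: continuous on `[0,1]`, twice continuously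
differentiable on `(0,1)`, solving `F'' + (2/r)F' - (l(l+1)/r²)F = f'(σ_s)F` with
`lim_{r→0⁺} F'(r) = 0` and `F(1) = -σ_s'(1)`. -/
def RadF (f σs : ℝ → ℝ) (l : ℕ) (F : ℝ → ℝ) : Prop :=
  ContinuousOn F (Icc 0 1) ∧
  (∀ r ∈ Ioo (0:ℝ) 1, HasDerivAt F (deriv F r) r) ∧
  (∀ r ∈ Ioo (0:ℝ) 1, HasDerivAt (deriv F) (deriv (deriv F) r) r) ∧
  ContinuousOn (deriv F) (Ioo 0 1) ∧
  ContinuousOn (deriv (deriv F)) (Ioo 0 1) ∧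
  (∀ r ∈ Ioo (0:ℝ) 1,
    deriv (deriv F) r + (2 / r) * deriv F r - ((l : ℝ) * ((l : ℝ) + 1) / r ^ 2) * F r
      = deriv f (σs r) * F r) ∧
  Tendsto (deriv F) (nhdsWithin 0 (Ioi 0)) (nhds 0) ∧
  F 1 = -deriv σs 1

/-- The radially symmetric stationary solution `(σ_s, v_s, p_s)` on `[0,R]` of the
free boundary tumor problem with Stokes equations, surface tension coefficient `γ`. -/
def IsRadialStationary (f g : ℝ → ℝ) (γ R : ℝ) (σ v p : ℝ → ℝ) : Prop :=
  -- regularity of σ: continuous on [0,R], C² on (0,R]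
  ContinuousOn σ (Icc 0 R) ∧
  (∀ r ∈ Ioc (0:ℝ) R, HasDerivAt σ (deriv σ r) r) ∧
  (∀ r ∈ Ioc (0:ℝ) R, HasDerivAt (deriv σ) (deriv (deriv σ) r) r) ∧
  ContinuousOn (deriv σ) (Ioc 0 R) ∧ ContinuousOn (deriv (deriv σ)) (Ioc 0 R) ∧
  -- (i) σ'' + (2/r)σ' = f(σ), σ ≥ 0 on (0,R], lim_{r→0⁺} σ'(r) = 0, σ(R) = 1
  (∀ r ∈ Ioc (0:ℝ) R, deriv (deriv σ) r + (2 / r) * deriv σ r = f (σ r) ∧ 0 ≤ σ r) ∧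
  Tendsto (deriv σ) (nhdsWithin 0 (Ioi 0)) (nhds 0) ∧
  σ R = 1 ∧
  -- regularity of v: continuous on [0,R], C² on (0,R]
  ContinuousOn v (Icc 0 R) ∧
  (∀ r ∈ Ioc (0:ℝ) R, HasDerivAt v (deriv v r) r) ∧
  (∀ r ∈ Ioc (0:ℝ) R, HasDerivAt (deriv v) (deriv (deriv v) r) r) ∧
  ContinuousOn (deriv v) (Ioc 0 R) ∧ ContinuousOn (deriv (deriv v)) (Ioc 0 R) ∧
  -- (ii) v' + (2/r)v = g(σ) on (0,R], v(0) = 0, v(R) = 0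
  (∀ r ∈ Ioc (0:ℝ) R, deriv v r + (2 / r) * v r = g (σ r)) ∧
  v 0 = 0 ∧ v R = 0 ∧
  -- regularity of p: continuous on [0,R], C² on (0,R]
  ContinuousOn p (Icc 0 R) ∧
  (∀ r ∈ Ioc (0:ℝ) R, HasDerivAt p (deriv p r) r) ∧
  (∀ r ∈ Ioc (0:ℝ) R, HasDerivAt (deriv p) (deriv (deriv p) r) r) ∧
  ContinuousOn (deriv p) (Ioc 0 R) ∧ ContinuousOn (deriv (deriv p)) (Ioc 0 R) ∧
  -- (iii) (d²/dr² + (2/r)d/dr)(p - (4/3)g(σ)) = 0 on (0,R],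
  --       lim_{r→0⁺} p'(r) = 0, p(R) = γ/R + (4/3)g(1)
  (∀ r ∈ Ioc (0:ℝ) R,
      deriv (deriv (fun s => p s - (4 / 3) * g (σ s))) r
        + (2 / r) * deriv (fun s => p s - (4 / 3) * g (σ s)) r = 0) ∧
  Tendsto (deriv p) (nhdsWithin 0 (Ioi 0)) (nhds 0) ∧
  p R = γ / R + (4 / 3) * g 1


def Nop (h : ℝ → ℝ) (x : ℝ) : ℝ := (∫ t in (0:ℝ)..x, t ^ 2 * h t) / x ^ 2

lemma Nop_zero (h : ℝ → ℝ) : Nop h 0 = 0 := by simp [Nop]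

lemma Nop_cont_ii {h : ℝ → ℝ} (hh : Continuous h) (a b : ℝ) :
    IntervalIntegrable (fun t => t ^ 2 * h t) volume a b :=
  Continuous.intervalIntegrable (by fun_prop) _ _

lemma Nop_hasDerivAt {h : ℝ → ℝ} (hh : Continuous h) {x : ℝ} (hx : x ≠ 0) :
    HasDerivAt (Nop h) (h x - 2 / x * Nop h x) x := by
  have hc : Continuous (fun t => t ^ 2 * h t) := by fun_prop
  have h1 : HasDerivAt (fun x => ∫ t in (0:ℝ)..x, t ^ 2 * h t) (x ^ 2 * h x) x :=
    intervalIntegral.integral_hasDerivAt_right (hc.intervalIntegrable _ _)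
      hc.aestronglyMeasurable.stronglyMeasurableAtFilter hc.continuousAt
  have h2 := h1.div (hasDerivAt_pow 2 x) (pow_ne_zero 2 hx)
  refine h2.congr_deriv ?_
  unfold Nop
  field_simp
  push_cast
  ring

lemma Nop_abs_le {h : ℝ → ℝ} {C y : ℝ} (hb : ∀ t ∈ uIoc 0 y, |h t| ≤ C) :
    |Nop h y| ≤ C * |y| := by
  rcases eq_or_ne y 0 with rfl | hy
  · simp [Nop_zero]
  have hy2 : 0 < y ^ 2 := by positivity
  have : ‖∫ t in (0:ℝ)..y, t ^ 2 * h t‖ ≤ (y ^ 2 * C) * |y - 0| := by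
    apply intervalIntegral.norm_integral_le_of_norm_le_const
    intro t ht
    rw [Real.norm_eq_abs, abs_mul, abs_of_nonneg (sq_nonneg t)]
    have ht2 : t ^ 2 ≤ y ^ 2 := by
      apply sq_le_sq.mpr
      rcases le_total 0 y with h0 | h0
      · rw [uIoc_of_le h0] at ht
        rw [abs_of_pos ht.1, abs_of_nonneg h0]; exact ht.2
      · rw [uIoc_of_ge h0] at ht
        rw [abs_of_nonpos ht.2, abs_of_nonpos h0]; linarith [ht.1]
    exact mul_le_mul ht2 (hb t ht) (abs_nonneg _) hy2.le
  unfold Nop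
  rw [abs_div, abs_of_pos hy2, div_le_iff₀ hy2]
  rw [Real.norm_eq_abs, sub_zero] at this
  linarith

lemma Nop_continuous {h : ℝ → ℝ} (hh : Continuous h) : Continuous (Nop h) := by
  rw [continuous_iff_continuousAt]
  intro x
  rcases eq_or_ne x 0 with rfl | hx
  · obtain ⟨C, hC⟩ := (isCompact_Icc (a := (-1:ℝ)) (b := 1)).exists_bound_of_continuousOn
      hh.continuousOn
    unfold ContinuousAt
    rw [Nop_zero]
    apply squeeze_zero_norm' (a := fun y => C * |y|)
    · filter_upwards [Icc_mem_nhds (show (-1:ℝ) < 0 by norm_num) (show (0:ℝ) < 1 by norm_num)] with y hy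
      apply Nop_abs_le
      intro t ht
      apply hC
      rcases le_total 0 y with h0 | h0
      · rw [uIoc_of_le h0] at ht
        exact ⟨by linarith [ht.1], by linarith [ht.2, hy.2]⟩
      · rw [uIoc_of_ge h0] at ht
        exact ⟨by linarith [ht.1, hy.1], by linarith [ht.2]⟩
    · have : Continuous (fun y : ℝ => C * |y|) := by fun_prop
      simpa using this.tendsto 0
  · exact (Nop_hasDerivAt hh hx).continuousAt

lemma Nop_nonneg {h : ℝ → ℝ} (hn : ∀ t, 0 ≤ h t) {x : ℝ} (hx : 0 ≤ x) : 0 ≤ Nop h x := by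
  unfold Nop
  apply div_nonneg _ (sq_nonneg _)
  exact intervalIntegral.integral_nonneg hx (fun t _ => mul_nonneg (sq_nonneg _) (hn t))

lemma Nop_sub {h k : ℝ → ℝ} (hh : Continuous h) (hk : Continuous k) (x : ℝ) :
    Nop h x - Nop k x = Nop (fun t => h t - k t) x := by
  unfold Nop
  rw [← sub_div, ← intervalIntegral.integral_sub (Nop_cont_ii hh _ _) (Nop_cont_ii hk _ _)]
  congr 2
  ext t
  ring

lemma SN_hasDerivAt {h : ℝ → ℝ} (hh : Continuous h) (x : ℝ) :
    HasDerivAt (fun x => ∫ y in (0:ℝ)..x, Nop h y) (Nop h x) x :=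
  intervalIntegral.integral_hasDerivAt_right ((Nop_continuous hh).intervalIntegrable _ _)
      (Nop_continuous hh).aestronglyMeasurable.stronglyMeasurableAtFilter
      (Nop_continuous hh).continuousAt

lemma int_exp_le {M x : ℝ} (hM : 0 < M) :
    ∫ y in (0:ℝ)..x, Real.exp (M * y) ≤ Real.exp (M * x) / M := by
  have : ∫ y in (0:ℝ)..x, Real.exp (M * y) = Real.exp (M * x) / M - Real.exp (M * 0) / M := by
    apply intervalIntegral.integral_eq_sub_of_hasDerivAt
      (f := fun y => Real.exp (M * y) / M)
    · intro y _
      have := ((hasDerivAt_id y).const_mul M).exp.div_const M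
      refine this.congr_deriv ?_
      simp; field_simp
    · exact Continuous.intervalIntegrable (by fun_prop) _ _
  rw [this]
  have : 0 < Real.exp (M * 0) / M := by positivity
  linarith

def HZ (F : ℝ → ℝ) (M : ℝ) (z : C(Icc (0:ℝ) 1, ℝ)) (t : ℝ) : ℝ :=
  F (Real.exp (M * t) * IccExtend (zero_le_one' ℝ) z t)

lemma HZ_cont {F : ℝ → ℝ} (hF : Continuous F) (M : ℝ) (z : C(Icc (0:ℝ) 1, ℝ)) :
    Continuous (HZ F M z) := by
  have : Continuous (IccExtend (zero_le_one' ℝ) z) := z.continuous.Icc_extend'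
  unfold HZ
  fun_prop

def Phi (F : ℝ → ℝ) (hF : Continuous F) (M lam a : ℝ) (z : C(Icc (0:ℝ) 1, ℝ)) :
    C(Icc (0:ℝ) 1, ℝ) where
  toFun x := Real.exp (-(M * x)) * (a + lam * ∫ y in (0:ℝ)..x, Nop (HZ F M z) y)
  continuous_toFun := by
    have : Continuous (fun x => ∫ y in (0:ℝ)..x, Nop (HZ F M z) y) :=
      continuous_iff_continuousAt.mpr fun x => (SN_hasDerivAt (HZ_cont hF M z) x).continuousAt
    fun_prop

lemma Phi_contr {F : ℝ → ℝ} (hF : Continuous F) {K : ℝ} (hK0 : 0 ≤ K)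
    (hK : ∀ x y, |F x - F y| ≤ K * |x - y|) {M lam : ℝ} (hM : 0 < M) (hl : 0 ≤ lam)
    (hML : 2 * lam * K ≤ M) (a : ℝ) :
    ContractingWith (1/2) (Phi F hF M lam a) := by
  refine ⟨by rw [← NNReal.coe_lt_coe]; norm_num, ?_⟩
  apply LipschitzWith.of_dist_le_mul
  intro z w
  rw [ContinuousMap.dist_le (by positivity)]
  rintro ⟨x, hx⟩
  set d := dist z w with hd
  have hd0 : 0 ≤ d := dist_nonneg
  have h1 : ∀ t, |HZ F M z t - HZ F M w t| ≤ K * Real.exp (M * t) * d := by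
    intro t
    refine (hK _ _).trans ?_
    rw [← mul_sub, abs_mul, abs_of_pos (Real.exp_pos _), mul_assoc]
    gcongr
    exact ContinuousMap.dist_apply_le_dist (f := z) (g := w) _
  have h2 : ∀ y ∈ Icc (0:ℝ) 1, |Nop (HZ F M z) y - Nop (HZ F M w) y| ≤ K * d * Real.exp (M * y) := by
    intro y hy
    rw [Nop_sub (HZ_cont hF M z) (HZ_cont hF M w)]
    have := Nop_abs_le (h := fun t => HZ F M z t - HZ F M w t) (C := K * d * Real.exp (M * y)) (y := y) (by
      intro t ht
      rw [uIoc_of_le hy.1] at ht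
      refine (h1 t).trans ?_
      have : Real.exp (M * t) ≤ Real.exp (M * y) := by
        apply Real.exp_le_exp.mpr; exact mul_le_mul_of_nonneg_left ht.2 hM.le
      calc K * Real.exp (M * t) * d = K * d * Real.exp (M * t) := by ring
        _ ≤ _ := by gcongr)
    refine this.trans ?_
    rw [abs_of_nonneg hy.1]
    have h0 : 0 ≤ K * d * Real.exp (M * y) := by positivity
    nlinarith [hy.2]
  have h3 : |(∫ y in (0:ℝ)..x, Nop (HZ F M z) y) - ∫ y in (0:ℝ)..x, Nop (HZ F M w) y|
      ≤ K * d * (Real.exp (M * x) / M) := by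
    rw [← intervalIntegral.integral_sub
      ((Nop_continuous (HZ_cont hF M z)).intervalIntegrable _ _)
      ((Nop_continuous (HZ_cont hF M w)).intervalIntegrable _ _)]
    have := intervalIntegral.norm_integral_le_of_norm_le (a := 0) (b := x) (μ := volume)
      (f := fun y => Nop (HZ F M z) y - Nop (HZ F M w) y)
      (g := fun y => K * d * Real.exp (M * y)) hx.1
      (ae_of_all _ fun t ht => h2 t ⟨ht.1.le, ht.2.trans hx.2⟩)
      (Continuous.intervalIntegrable (by fun_prop) _ _)
    refine this.trans ?_
    rw [intervalIntegral.integral_const_mul]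
    exact mul_le_mul_of_nonneg_left (int_exp_le hM) (by positivity)
  rw [Real.dist_eq]
  change |Real.exp (-(M * x)) * (a + lam * ∫ y in (0:ℝ)..x, Nop (HZ F M z) y)
    - Real.exp (-(M * x)) * (a + lam * ∫ y in (0:ℝ)..x, Nop (HZ F M w) y)| ≤ _
  have e1 : Real.exp (-(M * x)) * (a + lam * ∫ y in (0:ℝ)..x, Nop (HZ F M z) y)
    - Real.exp (-(M * x)) * (a + lam * ∫ y in (0:ℝ)..x, Nop (HZ F M w) y)
    = Real.exp (-(M * x)) * lam * ((∫ y in (0:ℝ)..x, Nop (HZ F M z) y) - ∫ y in (0:ℝ)..x, Nop (HZ F M w) y) := by ring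
  rw [e1, abs_mul, abs_of_nonneg (by positivity : 0 ≤ Real.exp (-(M * x)) * lam)]
  calc _ ≤ Real.exp (-(M * x)) * lam * (K * d * (Real.exp (M * x) / M)) := by gcongr
    _ = (Real.exp (-(M * x)) * Real.exp (M * x)) * (lam * K / M) * d := by ring
    _ = (lam * K / M) * d := by rw [← Real.exp_add]; simp
    _ ≤ _ := by
      apply mul_le_mul_of_nonneg_right _ hd0
      rw [div_le_iff₀ hM]; simp; linarith

lemma ivp {F : ℝ → ℝ} (hF : Continuous F) {K : ℝ} (hK0 : 0 ≤ K)
    (hK : ∀ x y, |F x - F y| ≤ K * |x - y|) {lam : ℝ} (hl : 0 ≤ lam) (hF0 : F 0 = 0) :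
    ∃ U : ℝ → ℝ → ℝ, (∀ a, Continuous (U a)) ∧
      (∀ a, ∀ x ∈ Icc (0:ℝ) 1, U a x = a + lam * ∫ y in (0:ℝ)..x, Nop (fun t => F (U a t)) y) ∧
      Continuous (fun a => U a 1) ∧ U 0 1 = 0 := by
  obtain ⟨M, hM, hML⟩ : ∃ M : ℝ, 0 < M ∧ 2 * lam * K ≤ M :=
    ⟨2 * lam * K + 1, by positivity, by linarith⟩
  have hc := fun a => Phi_contr hF hK0 hK hM hl hML a
  set Z : ℝ → C(Icc (0:ℝ) 1, ℝ) := fun a => ContractingWith.fixedPoint _ (hc a) with hZ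
  have hfix : ∀ a, Phi F hF M lam a (Z a) = Z a := fun a => (hc a).fixedPoint_isFixedPt
  have hZc : Continuous Z := by
    apply LipschitzWith.continuous (K := 2)
    apply LipschitzWith.of_dist_le_mul
    intro a b
    have := (hc a).fixedPoint_lipschitz_in_map (hc b) (C := dist a b) (by
      intro z
      rw [ContinuousMap.dist_le dist_nonneg]
      rintro ⟨x, hx⟩
      rw [Real.dist_eq]
      change |Real.exp (-(M * x)) * (a + lam * ∫ y in (0:ℝ)..x, Nop (HZ F M z) y)
        - Real.exp (-(M * x)) * (b + lam * ∫ y in (0:ℝ)..x, Nop (HZ F M z) y)| ≤ _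
      rw [← mul_sub, add_sub_add_right_eq_sub, abs_mul, abs_of_pos (Real.exp_pos _), Real.dist_eq]
      have : Real.exp (-(M * x)) ≤ 1 := Real.exp_le_one_iff.mpr (by nlinarith [hx.1])
      nlinarith [abs_nonneg (a - b)])
    refine this.trans (le_of_eq ?_)
    norm_num
    ring
  refine ⟨fun a t => Real.exp (M * t) * IccExtend (zero_le_one' ℝ) (Z a) t, ?_, ?_, ?_, ?_⟩
  · intro a
    have : Continuous (IccExtend (zero_le_one' ℝ) (Z a)) := (Z a).continuous.Icc_extend'
    fun_prop
  · intro a x hx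
    have h1 : IccExtend (zero_le_one' ℝ) (Z a) x = Z a ⟨x, hx⟩ := IccExtend_of_mem _ _ hx
    have h2 : Z a ⟨x, hx⟩ = Real.exp (-(M * x)) * (a + lam * ∫ y in (0:ℝ)..x, Nop (HZ F M (Z a)) y) := by
      conv_lhs => rw [← hfix a]
      rfl
    simp only [h1]
    rw [h2, ← mul_assoc, ← Real.exp_add, add_neg_cancel, Real.exp_zero, one_mul]
    rfl
  · have : ∀ a, IccExtend (zero_le_one' ℝ) (Z a) 1 = Z a ⟨1, by simp⟩ :=
      fun a => IccExtend_of_mem _ _ _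
    simp only [this]
    fun_prop
  · have h0 : Z 0 = 0 := by
      symm
      apply (hc 0).fixedPoint_unique
      change Phi F hF M lam 0 0 = 0
      ext x
      have hz : HZ F M 0 = fun _ => 0 := by
        ext t; simp [HZ, IccExtend, hF0]
      have : Nop (HZ F M 0) = fun _ => 0 := by
        ext y; simp [hz, Nop]
      change Real.exp (-(M * x)) * (0 + lam * ∫ y in (0:ℝ)..x, Nop (HZ F M 0) y) = 0
      rw [this]; simp
    simp [h0, IccExtend]

lemma phi_cont {dw k : ℝ → ℝ} {R : ℝ}
    (d2 : ∀ x ∈ Ioo (0:ℝ) R, HasDerivAt dw (k x) x)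
    (t0 : Tendsto dw (nhdsWithin 0 (Ioi 0)) (nhds 0)) :
    ContinuousOn (fun x => x ^ 2 * dw x) (Ico 0 R) := by
  intro x hx
  rcases eq_or_lt_of_le hx.1 with rfl | h0
  · have : ContinuousWithinAt (fun x => x ^ 2 * dw x) (Ioi 0) 0 := by
      unfold ContinuousWithinAt
      have h1 : Tendsto (fun x : ℝ => x ^ 2) (nhdsWithin 0 (Ioi 0)) (nhds 0) := by
        have : Continuous (fun x : ℝ => x ^ 2) := by fun_prop
        simpa using (this.tendsto 0).mono_left nhdsWithin_le_nhds
      simpa using h1.mul t0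
    exact (continuousWithinAt_Ioi_iff_Ici.mp this).mono Ico_subset_Ici_self
  · have := (d2 x ⟨h0, hx.2⟩).continuousAt
    exact ContinuousAt.continuousWithinAt (by fun_prop)

lemma max_principle {w dw k : ℝ → ℝ}
    (c : ContinuousOn w (Icc 0 1))
    (d1 : ∀ x ∈ Ioo (0:ℝ) 1, HasDerivAt w (dw x) x)
    (d2 : ∀ x ∈ Ioo (0:ℝ) 1, HasDerivAt dw (k x - 2 / x * dw x) x)
    (t0 : Tendsto dw (nhdsWithin 0 (Ioi 0)) (nhds 0))
    (h1 : w 1 ≤ 0) (hk : ∀ x ∈ Ioo (0:ℝ) 1, 0 < w x → 0 < k x) :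
    ∀ x ∈ Icc (0:ℝ) 1, w x ≤ 0 := by
  obtain ⟨m, hm, hmax⟩ := isCompact_Icc.exists_isMaxOn (nonempty_Icc.mpr (zero_le_one' ℝ)) c
  have hmax' : ∀ x ∈ Icc (0:ℝ) 1, w x ≤ w m := hmax
  by_contra! hcon
  obtain ⟨x0, hx0, hpos⟩ := hcon
  have hwm : 0 < w m := hpos.trans_le (hmax' x0 hx0)
  have hm1 : m < 1 := by
    rcases eq_or_lt_of_le hm.2 with h | h
    · subst h; linarith
    · exact h
  have hφc := phi_cont d2 t0
  have hφm : m ^ 2 * dw m = 0 := by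
    rcases eq_or_lt_of_le hm.1 with h | h
    · subst h; simp
    · have hlm : IsLocalMax w m := hmax.isLocalMax (Icc_mem_nhds h hm1)
      rw [hlm.hasDerivAt_eq_zero (d1 m ⟨h, hm1⟩)]; simp
  -- neighborhood on the right
  have hcm : ContinuousWithinAt w (Icc 0 1) m := c m hm
  have hev : ∀ᶠ x in nhdsWithin m (Icc 0 1), 0 < w x := hcm.eventually (lt_mem_nhds hwm)
  rw [eventually_nhdsWithin_iff, Metric.eventually_nhds_iff] at hev
  obtain ⟨δ, hδ, hev⟩ := hev
  obtain ⟨b, hmb, hb1, hbd⟩ : ∃ b, m < b ∧ b < 1 ∧ b < m + δ := by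
    obtain ⟨b, hb⟩ := exists_between (lt_min hm1 (by linarith : m < m + δ))
    exact ⟨b, hb.1, hb.2.trans_le (min_le_left _ _), hb.2.trans_le (min_le_right _ _)⟩
  have hwpos : ∀ x ∈ Ioo m b, 0 < w x := by
    intro x hx
    apply hev
    · rw [Real.dist_eq, abs_of_pos (by linarith [hx.1])]; linarith [hx.2]
    · exact ⟨by linarith [hx.1, hm.1], by linarith [hx.2]⟩
  have hmono : StrictMonoOn (fun x => x ^ 2 * dw x) (Icc m b) := by
    apply strictMonoOn_of_deriv_pos (convex_Icc _ _)
    · exact hφc.mono (fun x hx => ⟨hm.1.trans hx.1, hx.2.trans_lt hb1⟩)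
    · intro x hx
      rw [interior_Icc] at hx
      have hx0 : 0 < x := hm.1.trans_lt hx.1
      have hx01 : x ∈ Ioo (0:ℝ) 1 := ⟨hx0, hx.2.trans hb1⟩
      have := ((hasDerivAt_pow 2 x).mul (d2 x hx01)).deriv
      have e : deriv (fun x => x ^ 2 * dw x) x = x ^ 2 * k x := by
        refine Eq.trans this ?_
        field_simp; push_cast; ring
      rw [e]
      have := hk x hx01 (hwpos x hx)
      positivity
  have hwmono : StrictMonoOn w (Icc m b) := by
    apply strictMonoOn_of_deriv_pos (convex_Icc _ _)
    · exact c.mono (fun x hx => ⟨hm.1.trans hx.1, (hx.2.trans_lt hb1).le⟩)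
    · intro x hx
      rw [interior_Icc] at hx
      have hx0 : 0 < x := hm.1.trans_lt hx.1
      rw [(d1 x ⟨hx0, hx.2.trans hb1⟩).deriv]
      have := hmono (left_mem_Icc.mpr hmb.le) (Ioo_subset_Icc_self hx) hx.1
      simp only [hφm] at this
      exact pos_of_mul_pos_right this (by positivity)
  have := hwmono (left_mem_Icc.mpr hmb.le) (right_mem_Icc.mpr hmb.le) hmb
  have := hmax' b ⟨hm.1.trans hmb.le, hb1.le⟩
  linarith

lemma zero_lemma {w : ℝ → ℝ} {R : ℝ}
    (d : ∀ x ∈ Ioo (0:ℝ) R, HasDerivAt w (-(2 / x) * w x) x)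
    (t0 : Tendsto w (nhdsWithin 0 (Ioi 0)) (nhds 0)) :
    ∀ x ∈ Ioo (0:ℝ) R, w x = 0 := by
  intro x hx
  have hc := phi_cont d t0
  obtain ⟨c, hc, hs⟩ := exists_hasDerivAt_eq_slope (fun x => x ^ 2 * w x) (fun _ => 0) hx.1
    (hc.mono (fun y hy => ⟨hy.1, hy.2.trans_lt hx.2⟩)) (by
      intro y hy
      have hy0 := hy.1
      refine ((hasDerivAt_pow 2 y).mul (d y ⟨hy.1, hy.2.trans hx.2⟩)).congr_deriv ?_
      field_simp; push_cast; ring)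
  have hx0 := hx.1.ne'
  field_simp at hs
  simp at hs
  simpa [hx0] using hs

structure Sol (f : ℝ → ℝ) (lam : ℝ) (u du : ℝ → ℝ) : Prop where
  cont : ContinuousOn u (Icc 0 1)
  d1 : ∀ x ∈ Ioo (0:ℝ) 1, HasDerivAt u (du x) x
  d2 : ∀ x ∈ Ioo (0:ℝ) 1, HasDerivAt du (lam * f (u x) - 2 / x * du x) x
  t0 : Tendsto du (nhdsWithin 0 (Ioi 0)) (nhds 0)
  one : u 1 = 1
  nn : ∀ x ∈ Icc (0:ℝ) 1, 0 ≤ u x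

section
variable {f : ℝ → ℝ} {l1 l2 : ℝ} {u1 du1 u2 du2 : ℝ → ℝ}

lemma Sol.le_one (hf : StrictMonoOn f (Ici 0)) (hf0 : f 0 = 0) (hl : 0 < l1)
    (h : Sol f l1 u1 du1) : ∀ x ∈ Icc (0:ℝ) 1, u1 x ≤ 1 := by
  have := max_principle (w := fun x => u1 x - 1) (dw := du1) (k := fun x => l1 * f (u1 x))
    (h.cont.sub continuousOn_const) (fun x hx => (h.d1 x hx).sub_const 1) h.d2 h.t0
    (by simp [h.one]) (by
      intro x hx hp
      have : f 0 < f (u1 x) := hf (mem_Ici.mpr le_rfl) (mem_Ici.mpr (by linarith)) (by linarith)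
      rw [hf0] at this
      positivity)
  intro x hx
  have := this x hx
  linarith

lemma Sol.compare (hf : StrictMonoOn f (Ici 0)) (hf0 : f 0 = 0) (hl2 : 0 < l2) (hl : l2 ≤ l1)
    (h1 : Sol f l1 u1 du1) (h2 : Sol f l2 u2 du2) : ∀ x ∈ Icc (0:ℝ) 1, u1 x ≤ u2 x := by
  have := max_principle (w := fun x => u1 x - u2 x) (dw := fun x => du1 x - du2 x)
    (k := fun x => l1 * f (u1 x) - l2 * f (u2 x))
    (h1.cont.sub h2.cont) (fun x hx => (h1.d1 x hx).sub (h2.d1 x hx))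
    (fun x hx => ((h1.d2 x hx).sub (h2.d2 x hx)).congr_deriv (by ring))
    (by simpa using h1.t0.sub h2.t0)
    (by simp [h1.one, h2.one]) (by
      intro x hx hp
      have hx' := Ioo_subset_Icc_self hx
      have a := hf.monotoneOn (mem_Ici.mpr le_rfl) (mem_Ici.mpr (h2.nn x hx')) (h2.nn x hx')
      have b := hf (mem_Ici.mpr (h2.nn x hx')) (mem_Ici.mpr (h1.nn x hx')) (by linarith)
      rw [hf0] at a
      nlinarith)
  intro x hx
  have := this x hx
  linarith

lemma Sol.lip (hf : StrictMonoOn f (Ici 0)) (hf0 : f 0 = 0) (hl2 : 0 < l2) (hl : l2 ≤ l1)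
    (h1 : Sol f l1 u1 du1) (h2 : Sol f l2 u2 du2) :
    ∀ x ∈ Icc (0:ℝ) 1, u2 x - u1 x ≤ (l1 - l2) * f 1 := by
  have hf1 : 0 < f 1 := by
    have := hf (mem_Ici.mpr le_rfl) (mem_Ici.mpr zero_le_one) zero_lt_one
    rwa [hf0] at this
  set c := (l1 - l2) * f 1 / 6 with hc
  have hc0 : 0 ≤ c := by
    have : 0 ≤ l1 - l2 := by linarith
    positivity
  have := max_principle (w := fun x => u2 x - u1 x + c * (x ^ 2 - 1))
    (dw := fun x => du2 x - du1 x + c * (2 * x))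
    (k := fun x => l2 * f (u2 x) - l1 * f (u1 x) + 6 * c)
    ((h2.cont.sub h1.cont).add (by fun_prop))
    (fun x hx => (((h2.d1 x hx).sub (h1.d1 x hx)).add
      (((hasDerivAt_pow 2 x).sub_const 1).const_mul c)).congr_deriv (by push_cast; ring))
    (fun x hx => (((h2.d2 x hx).sub (h1.d2 x hx)).add
      (((hasDerivAt_id x).const_mul 2).const_mul c)).congr_deriv (by
        have := hx.1.ne'
        field_simp; ring))
    (by
      have h3 : Tendsto (fun x : ℝ => c * (2 * x)) (nhdsWithin 0 (Ioi 0)) (nhds 0) := by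
        have : Continuous (fun x : ℝ => c * (2 * x)) := by fun_prop
        simpa using (this.tendsto 0).mono_left nhdsWithin_le_nhds
      simpa using (h2.t0.sub h1.t0).add h3)
    (by simp [h1.one, h2.one]) (by
      intro x hx hp
      have hx' := Ioo_subset_Icc_self hx
      have hcx : 0 ≤ c * (1 - x ^ 2) := mul_nonneg hc0 (by nlinarith [hx.1, hx.2])
      have hlt : u1 x < u2 x := by linarith
      have b := hf (mem_Ici.mpr (h1.nn x hx')) (mem_Ici.mpr (h2.nn x hx')) hlt
      have a := hf.monotoneOn (mem_Ici.mpr (h1.nn x hx')) (mem_Ici.mpr zero_le_one)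
        (h1.le_one hf hf0 (hl2.trans_le hl) x hx')
      simp only [hc]
      nlinarith)
  intro x hx
  have := this x hx
  have hcx : 0 ≤ c * x ^ 2 := by positivity
  have : u2 x - u1 x ≤ c := by linarith
  have : (l1 - l2) * f 1 = 6 * c := by rw [hc]; ring
  linarith

lemma Sol.unique {g V1 V2 : ℝ → ℝ} (hf : StrictMonoOn f (Ici 0)) (hg : StrictMonoOn g (Ici 0))
    (hf0 : f 0 = 0) (hl2 : 0 < l2) (hl : l2 ≤ l1)
    (h1 : Sol f l1 u1 du1) (h2 : Sol f l2 u2 du2)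
    (c1 : ContinuousOn V1 (Icc 0 1)) (c2 : ContinuousOn V2 (Icc 0 1))
    (e1 : V1 1 = 0) (e2 : V2 1 = 0)
    (d1 : ∀ x ∈ Ioo (0:ℝ) 1, HasDerivAt V1 (g (u1 x) - 2 / x * V1 x) x)
    (d2 : ∀ x ∈ Ioo (0:ℝ) 1, HasDerivAt V2 (g (u2 x) - 2 / x * V2 x) x) :
    l1 = l2 ∧ ∀ x ∈ Icc (0:ℝ) 1, u1 x = u2 x := by
  have hle := h1.compare hf hf0 hl2 hl h2
  set y : ℝ → ℝ := fun x => x ^ 2 * (V1 x - V2 x) with hy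
  have hyd : ∀ x ∈ Ioo (0:ℝ) 1, HasDerivAt y (x ^ 2 * (g (u1 x) - g (u2 x))) x := by
    intro x hx
    have := hx.1.ne'
    refine ((hasDerivAt_pow 2 x).mul ((d1 x hx).sub (d2 x hx))).congr_deriv ?_
    field_simp; push_cast; simp only [Pi.sub_apply]; ring
  have hyc : ContinuousOn y (Icc 0 1) := by
    have := c1.sub c2
    exact ContinuousOn.mul (by fun_prop) this
  have hya : AntitoneOn y (Icc 0 1) := by
    apply antitoneOn_of_deriv_nonpos (convex_Icc _ _) hyc
    · intro x hx; rw [interior_Icc] at hx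
      exact (hyd x hx).differentiableAt.differentiableWithinAt
    · intro x hx; rw [interior_Icc] at hx
      have hx' := Ioo_subset_Icc_self hx
      rw [(hyd x hx).deriv]
      have := hg.monotoneOn (mem_Ici.mpr (h1.nn x hx')) (mem_Ici.mpr (h2.nn x hx')) (hle x hx')
      nlinarith [sq_nonneg x]
  have hy0 : ∀ x ∈ Icc (0:ℝ) 1, y x = 0 := by
    intro x hx
    have a := hya (left_mem_Icc.mpr zero_le_one) hx hx.1
    have b := hya hx (right_mem_Icc.mpr zero_le_one) hx.2
    have : y 0 = 0 := by simp [hy]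
    have : y 1 = 0 := by simp [hy, e1, e2]
    linarith
  have hu : ∀ x ∈ Ioo (0:ℝ) 1, u1 x = u2 x := by
    intro x hx
    have hx' := Ioo_subset_Icc_self hx
    have hz : HasDerivAt y 0 x := by
      refine (hasDerivAt_const x (0:ℝ)).congr_of_eventuallyEq ?_
      filter_upwards [Ioo_mem_nhds hx.1 hx.2] with t ht
      exact hy0 t (Ioo_subset_Icc_self ht)
    have := (hyd x hx).unique hz
    have hx2 : x ^ 2 ≠ 0 := pow_ne_zero 2 hx.1.ne'
    have hgg : g (u1 x) = g (u2 x) := by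
      have := (mul_eq_zero.mp this).resolve_left hx2
      linarith
    exact hg.injOn (mem_Ici.mpr (h1.nn x hx')) (mem_Ici.mpr (h2.nn x hx')) hgg
  have hdu : ∀ x ∈ Ioo (0:ℝ) 1, du1 x = du2 x := by
    intro x hx
    refine (h1.d1 x hx).unique ((h2.d1 x hx).congr_of_eventuallyEq ?_)
    filter_upwards [Ioo_mem_nhds hx.1 hx.2] with t ht using hu t ht
  have hll : ∀ x ∈ Ioo (0:ℝ) 1, l1 * f (u1 x) = l2 * f (u1 x) := by
    intro x hx
    have := (h1.d2 x hx).unique ((h2.d2 x hx).congr_of_eventuallyEq (by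
      filter_upwards [Ioo_mem_nhds hx.1 hx.2] with t ht using hdu t ht))
    rw [hdu x hx, ← hu x hx] at this
    linarith
  have hclos : EqOn u1 u2 (Icc 0 1) := by
    have : Icc (0:ℝ) 1 = closure (Ioo 0 1) := (closure_Ioo zero_ne_one).symm
    have hs : EqOn u1 u2 (Ioo 0 1) := hu
    exact hs.of_subset_closure h1.cont h2.cont Ioo_subset_Icc_self this.subset
  refine ⟨?_, hclos⟩
  by_contra hne
  have hz : EqOn u1 (fun _ => 0) (Ioo 0 1) := by
    intro x hx
    have hx' := Ioo_subset_Icc_self hx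
    have h := hll x hx
    have : (l1 - l2) * f (u1 x) = 0 := by linarith
    have := (mul_eq_zero.mp this).resolve_left (sub_ne_zero.mpr hne)
    exact hf.injOn (mem_Ici.mpr (h1.nn x hx')) (mem_Ici.mpr le_rfl) (by rw [this, hf0])
  have := hz.of_subset_closure h1.cont continuousOn_const Ioo_subset_Icc_self
    (closure_Ioo zero_ne_one).symm.subset (right_mem_Icc.mpr zero_le_one)
  simp [h1.one] at this
end

lemma lip01 {f : ℝ → ℝ} (h : ContDiffOn ℝ (⊤ : ℕ∞) f (Ici 0)) :
    ∃ K : ℝ, 0 ≤ K ∧ ∀ x ∈ Icc (0:ℝ) 1, ∀ y ∈ Icc (0:ℝ) 1, |f x - f y| ≤ K * |x - y| := by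
  obtain ⟨K, hK⟩ := (h.mono (Icc_subset_Ici_self : Icc (0:ℝ) 1 ⊆ Ici 0)).exists_lipschitzOnWith
    (by simp) (convex_Icc _ _) isCompact_Icc
  refine ⟨K, K.2, fun x hx y hy => ?_⟩
  simpa [Real.dist_eq] using hK.dist_le_mul x hx y hy

lemma smono {f : ℝ → ℝ} (h : ContDiffOn ℝ (⊤ : ℕ∞) f (Ici 0))
    (h' : ∀ σ : ℝ, 0 ≤ σ → 0 < deriv f σ) : StrictMonoOn f (Ici 0) :=
  strictMonoOn_of_deriv_pos (convex_Ici 0) h.continuousOn (fun x hx => by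
    rw [interior_Ici] at hx; exact h' x (le_of_lt hx))

structure BV (f : ℝ → ℝ) (lam : ℝ) (u du h : ℝ → ℝ) (a : ℝ) : Prop where
  ha : 0 < a
  uc : Continuous u
  duc : Continuous du
  hc : Continuous h
  d1 : ∀ x, 0 < x → HasDerivAt u (du x) x
  d2 : ∀ x, 0 < x → HasDerivAt du (lam * h x - 2 / x * du x) x
  du0 : du 0 = 0
  one : u 1 = 1
  lb : ∀ x, 0 ≤ x → a ≤ u x
  hh : ∀ x ∈ Icc (0:ℝ) 1, h x = f (u x)
  dun : ∀ x, 0 ≤ x → 0 ≤ du x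
  mono : MonotoneOn u (Ici 0)

lemma BV.sol {f : ℝ → ℝ} {lam : ℝ} {u du h : ℝ → ℝ} {a : ℝ} (H : BV f lam u du h a) :
    Sol f lam u du where
  cont := H.uc.continuousOn
  d1 x hx := H.d1 x hx.1
  d2 x hx := by
    have := H.d2 x hx.1
    rwa [H.hh x (Ioo_subset_Icc_self hx)] at this
  t0 := by
    have := H.duc.tendsto 0
    rw [H.du0] at this
    exact this.mono_left nhdsWithin_le_nhds
  one := H.one
  nn x hx := H.ha.le.trans (H.lb x hx.1)

lemma clamp_lip (x y : ℝ) : |max 0 (min x 1) - max 0 (min y 1)| ≤ |x - y| := by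
  refine (abs_max_sub_max_le_max 0 _ 0 _).trans ?_
  have := abs_min_sub_min_le_max x 1 y 1
  simpa using this

lemma bvp {f : ℝ → ℝ} (hf : A1cond f) {lam : ℝ} (hl : 0 < lam) :
    ∃ u du h : ℝ → ℝ, ∃ a : ℝ, BV f lam u du h a := by
  obtain ⟨hfs, hf0, hf'⟩ := hf
  have hfm := smono hfs hf'
  obtain ⟨K, hK0, hK⟩ := lip01 hfs
  have hcl : ∀ x : ℝ, max 0 (min x 1) ∈ Icc (0:ℝ) 1 := fun x =>
    ⟨le_max_left _ _, max_le zero_le_one (min_le_right _ _)⟩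
  set F : ℝ → ℝ := fun x => f (max 0 (min x 1)) with hF
  have hFc : Continuous F := by
    apply hfs.continuousOn.comp_continuous (by fun_prop)
    intro x; exact (hcl x).1
  have hFK : ∀ x y, |F x - F y| ≤ K * |x - y| := by
    intro x y
    refine (hK _ (hcl x) _ (hcl y)).trans ?_
    refine mul_le_mul_of_nonneg_left ?_ hK0
    exact clamp_lip x y
  have hFn : ∀ x, 0 ≤ F x := by
    intro x
    have := hfm.monotoneOn (mem_Ici.mpr le_rfl) (mem_Ici.mpr (hcl x).1) (hcl x).1
    rwa [hf0] at this
  have hFf : ∀ x ∈ Icc (0:ℝ) 1, F x = f x := by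
    intro x hx; simp [hF, hx.1, hx.2]
  have hF0 : F 0 = 0 := by rw [hFf 0 (by simp), hf0]
  obtain ⟨U, hUc, hU, hU1, hU0⟩ := ivp hFc hK0 hFK hl.le hF0
  have hc : ∀ a, Continuous (fun t => F (U a t)) := fun a => hFc.comp (hUc a)
  have hSn : ∀ a, ∀ x : ℝ, 0 ≤ x → 0 ≤ ∫ y in (0:ℝ)..x, Nop (fun t => F (U a t)) y := by
    intro a x hx
    exact intervalIntegral.integral_nonneg hx (fun y hy => Nop_nonneg (fun t => hFn _) hy.1)
  have h11 : 1 ≤ U 1 1 := by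
    rw [hU 1 1 (by simp)]
    have := hSn 1 1 zero_le_one
    nlinarith
  obtain ⟨a, ha, ha1⟩ : ∃ a ∈ Icc (0:ℝ) 1, U a 1 = 1 :=
    intermediate_value_Icc zero_le_one hU1.continuousOn ⟨by rw [hU0]; exact zero_le_one, h11⟩
  have ha0 : 0 < a := by
    rcases eq_or_lt_of_le ha.1 with h | h
    · subst h; rw [hU0] at ha1; norm_num at ha1
    · exact h
  set h : ℝ → ℝ := fun t => F (U a t) with hh
  set u : ℝ → ℝ := fun x => a + lam * ∫ y in (0:ℝ)..x, Nop h y with hu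
  have hd1 : ∀ x, HasDerivAt u (lam * Nop h x) x := fun x =>
    ((SN_hasDerivAt (hc a) x).const_mul lam).const_add a
  have huc : Continuous u := continuous_iff_continuousAt.mpr fun x => (hd1 x).continuousAt
  have huU : ∀ x ∈ Icc (0:ℝ) 1, U a x = u x := hU a
  have hdn : ∀ x : ℝ, 0 ≤ x → 0 ≤ lam * Nop h x := fun x hx =>
    mul_nonneg hl.le (Nop_nonneg (fun t => hFn _) hx)
  have hm : MonotoneOn u (Ici 0) := by
    apply monotoneOn_of_deriv_nonneg (convex_Ici 0) huc.continuousOn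
    · intro x _; exact (hd1 x).differentiableAt.differentiableWithinAt
    · intro x hx
      rw [interior_Ici] at hx
      rw [(hd1 x).deriv]; exact hdn x (le_of_lt hx)
  have hone : u 1 = 1 := by rw [← huU 1 (by simp), ha1]
  have hlb : ∀ x, 0 ≤ x → a ≤ u x := by
    intro x hx
    have : 0 ≤ ∫ y in (0:ℝ)..x, Nop h y := hSn a x hx
    have := mul_nonneg hl.le this
    simp only [hu]; linarith
  refine ⟨u, fun x => lam * Nop h x, h, a, ha0, huc, (Nop_continuous (hc a)).const_mul lam,
    hc a, fun x _ => hd1 x, ?_, by simp [Nop_zero], hone, hlb, ?_, hdn, hm⟩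
  · intro x hx
    exact ((Nop_hasDerivAt (hc a) hx.ne').const_mul lam).congr_deriv (by ring)
  · intro x hx
    simp only [hh]
    rw [huU x hx]
    apply hFf
    refine ⟨ha0.le.trans (hlb x hx.1), ?_⟩
    rw [← hone]
    exact hm (mem_Ici.mpr hx.1) (mem_Ici.mpr zero_le_one) hx.2

lemma small_lam {f : ℝ → ℝ} (hf : StrictMonoOn f (Ici 0)) (hf1 : 0 < f 1) {lam : ℝ} {u du : ℝ → ℝ}
    (hl : 0 < lam) (H : Sol f lam u du) :
    ∀ x ∈ Icc (0:ℝ) 1, 1 - u x ≤ lam * f 1 / 6 * (1 - x ^ 2) := by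
  set c := lam * f 1 / 6 with hc
  have := max_principle (w := fun x => 1 - u x + c * (x ^ 2 - 1))
    (dw := fun x => - du x + c * (2 * x))
    (k := fun x => - (lam * f (u x)) + 6 * c)
    ((continuousOn_const.sub H.cont).add (by fun_prop))
    (fun x hx => (((H.d1 x hx).const_sub 1).add
      (((hasDerivAt_pow 2 x).sub_const 1).const_mul c)).congr_deriv (by push_cast; ring))
    (fun x hx => (((H.d2 x hx).neg).add
      (((hasDerivAt_id x).const_mul 2).const_mul c)).congr_deriv (by
        have := hx.1.ne'
        field_simp; ring))
    (by
      have h3 : Tendsto (fun x : ℝ => c * (2 * x)) (nhdsWithin 0 (Ioi 0)) (nhds 0) := by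
        have : Continuous (fun x : ℝ => c * (2 * x)) := by fun_prop
        simpa using (this.tendsto 0).mono_left nhdsWithin_le_nhds
      simpa using H.t0.neg.add h3)
    (by simp [H.one]) (by
      intro x hx hp
      have hx' := Ioo_subset_Icc_self hx
      have hc0 : 0 ≤ c := by positivity
      have hcx : 0 ≤ c * (1 - x ^ 2) := mul_nonneg hc0 (by nlinarith [hx.1, hx.2])
      have hlt : u x < 1 := by linarith
      have b := hf (mem_Ici.mpr (H.nn x hx')) (mem_Ici.mpr zero_le_one) hlt
      simp only [hc]
      nlinarith)
  intro x hx
  have := this x hx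
  linarith

lemma BV.gcont {f g : ℝ → ℝ} {lam : ℝ} {u du h : ℝ → ℝ} {a : ℝ} (H : BV f lam u du h a)
    (hg : ContinuousOn g (Ici 0)) : ContinuousOn (fun x => x ^ 2 * g (u x)) (Icc 0 1) := by
  have : ContinuousOn (fun x => g (u x)) (Icc 0 1) :=
    hg.comp H.uc.continuousOn (fun x hx => mem_Ici.mpr (H.ha.le.trans (H.lb x hx.1)))
  exact ContinuousOn.mul (by fun_prop) this

lemma BV.gint {f g : ℝ → ℝ} {lam : ℝ} {u du h : ℝ → ℝ} {a : ℝ} (H : BV f lam u du h a)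
    (hg : ContinuousOn g (Ici 0)) {b c : ℝ} (hb : 0 ≤ b) (hbc : b ≤ c) (hc : c ≤ 1) :
    IntervalIntegrable (fun x => x ^ 2 * g (u x)) volume b c :=
  ((H.gcont hg).mono (Icc_subset_Icc hb hc)).intervalIntegrable_of_Icc hbc

lemma BV.le_one {f : ℝ → ℝ} {lam : ℝ} {u du h : ℝ → ℝ} {a : ℝ} (H : BV f lam u du h a) :
    ∀ x ∈ Icc (0:ℝ) 1, u x ≤ 1 := by
  intro x hx
  rw [← H.one]
  exact H.mono (mem_Ici.mpr hx.1) (mem_Ici.mpr zero_le_one) hx.2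

lemma BV.large {f : ℝ → ℝ} {lam : ℝ} {u du h : ℝ → ℝ} {a : ℝ} (H : BV f lam u du h a)
    (hf : StrictMonoOn f (Ici 0)) (hl : 0 < lam)
    {ε ρ : ℝ} (hε : 0 < ε) (hfε : 0 < f ε) (hρ : 1 / 2 ≤ ρ) (hρ1 : ρ < 1)
    (hlam : lam * f ε * (1 - ρ) ^ 2 = 8) : u ρ ≤ ε := by
  by_contra! hcon
  set c := lam * f ε / 4 with hc
  have hge : ∀ x ∈ Icc ρ 1, f ε ≤ f (u x) := by
    intro x hx
    have hux : u ρ ≤ u x := H.mono (mem_Ici.mpr (by linarith)) (mem_Ici.mpr (by linarith [hx.1])) hx.1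
    exact hf.monotoneOn (mem_Ici.mpr hε.le) (mem_Ici.mpr (by linarith)) (by linarith)
  have h1 : MonotoneOn (fun x => x ^ 2 * du x - c * (x - ρ)) (Icc ρ 1) := by
    have hd : ∀ x ∈ Ioo ρ 1, HasDerivAt (fun x => x ^ 2 * du x - c * (x - ρ))
        (x ^ 2 * (lam * f (u x)) - c) x := by
      intro x hx
      have hx0 : 0 < x := by linarith [hx.1]
      have e := H.d2 x hx0
      rw [H.hh x ⟨hx0.le, hx.2.le⟩] at e
      refine (((hasDerivAt_pow 2 x).mul e).sub
        (((hasDerivAt_id x).sub_const ρ).const_mul c)).congr_deriv ?_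
      field_simp; push_cast; ring
    apply monotoneOn_of_deriv_nonneg (convex_Icc _ _)
    · have := H.duc
      exact Continuous.continuousOn (by fun_prop)
    · intro x hx; rw [interior_Icc] at hx
      exact (hd x hx).differentiableAt.differentiableWithinAt
    · intro x hx; rw [interior_Icc] at hx
      rw [(hd x hx).deriv]
      have := hge x (Ioo_subset_Icc_self hx)
      have hx2 : 1 / 4 ≤ x ^ 2 := by nlinarith [hx.1]
      have : lam * f ε ≤ lam * f (u x) := by gcongr
      have h0 : 0 < lam * f ε := by positivity
      simp only [hc]
      nlinarith
  have h2 : MonotoneOn (fun x => u x - c * ((x - ρ) ^ 2 / 2)) (Icc ρ 1) := by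
    have hd : ∀ x ∈ Ioo ρ 1, HasDerivAt (fun x => u x - c * ((x - ρ) ^ 2 / 2))
        (du x - c * (x - ρ)) x := by
      intro x hx
      have hx0 : 0 < x := by linarith [hx.1]
      refine ((H.d1 x hx0).sub
        (((((hasDerivAt_id x).sub_const ρ).pow 2).div_const 2).const_mul c)).congr_deriv ?_
      simp
    apply monotoneOn_of_deriv_nonneg (convex_Icc _ _)
    · have := H.uc
      exact Continuous.continuousOn (by fun_prop)
    · intro x hx; rw [interior_Icc] at hx
      exact (hd x hx).differentiableAt.differentiableWithinAt
    · intro x hx; rw [interior_Icc] at hx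
      rw [(hd x hx).deriv]
      have := h1 (left_mem_Icc.mpr hρ1.le) (Ioo_subset_Icc_self hx) hx.1.le
      simp only [sub_self, mul_zero, sub_zero] at this
      have a1 : 0 ≤ ρ ^ 2 * du ρ := mul_nonneg (sq_nonneg _) (H.dun ρ (by linarith))
      have a2 := H.dun x (by linarith [hx.1])
      have a3 : x ^ 2 ≤ 1 := by nlinarith [hx.1, hx.2]
      nlinarith
  have := h2 (left_mem_Icc.mpr hρ1.le) (right_mem_Icc.mpr hρ1.le) hρ1.le
  simp only [H.one, sub_self] at this
  have e : c * ((1 - ρ) ^ 2 / 2) = 1 := by rw [hc]; linarith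
  rw [e] at this
  norm_num at this
  linarith

lemma exists_lam {f g : ℝ → ℝ} (hf : A1cond f) (hg : A2A3cond g) :
    ∃ lam : ℝ, 0 < lam ∧ ∃ u du h : ℝ → ℝ, ∃ a : ℝ, BV f lam u du h a ∧
      ∫ x in (0:ℝ)..1, x ^ 2 * g (u x) = 0 := by
  have hfm := smono hf.1 hf.2.2
  obtain ⟨hgs, hg', σc, hσ0, hσ1, hgσ⟩ := hg
  have hgm := smono hgs hg'
  have hgc := hgs.continuousOn
  obtain ⟨K, hK0, hK⟩ := lip01 hgs
  have hf0 := hf.2.1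
  have hfp : ∀ x, 0 < x → 0 < f x := by
    intro x hx
    have := hfm (mem_Ici.mpr le_rfl) (mem_Ici.mpr hx.le) hx
    rwa [hf0] at this
  have hf1 := hfp 1 one_pos
  have hB : ∀ lam : ℝ, ∃ u : ℝ → ℝ, 0 < lam → ∃ du h : ℝ → ℝ, ∃ a : ℝ, BV f lam u du h a := by
    intro lam
    by_cases hl : 0 < lam
    · obtain ⟨u, hu⟩ := bvp hf hl
      exact ⟨u, fun _ => hu⟩
    · exact ⟨id, fun h => absurd h hl⟩
  choose u hu using hB
  set G : ℝ → ℝ := fun lam => ∫ x in (0:ℝ)..1, x ^ 2 * g (u lam x) with hG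
  have hdist : ∀ l1 l2 : ℝ, 0 < l2 → l2 ≤ l1 → |G l1 - G l2| ≤ K * (f 1) * |l1 - l2| := by
    intro l1 l2 hl2 hl
    obtain ⟨du1, h1, a1, H1⟩ := hu l1 (hl2.trans_le hl)
    obtain ⟨du2, h2, a2, H2⟩ := hu l2 hl2
    simp only [hG]
    rw [← intervalIntegral.integral_sub (H1.gint hgc le_rfl zero_le_one le_rfl)
      (H2.gint hgc le_rfl zero_le_one le_rfl)]
    have := intervalIntegral.norm_integral_le_of_norm_le_const (a := (0:ℝ)) (b := 1)
      (f := fun x => x ^ 2 * g (u l1 x) - x ^ 2 * g (u l2 x)) (C := K * f 1 * |l1 - l2|) (by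
        intro x hx
        rw [uIoc_of_le zero_le_one] at hx
        have hx' : x ∈ Icc (0:ℝ) 1 := ⟨hx.1.le, hx.2⟩
        have A := H1.sol.compare hfm hf0 hl2 hl H2.sol x hx'
        have B := H1.sol.lip hfm hf0 hl2 hl H2.sol x hx'
        have C := hK _ ⟨H1.sol.nn x hx', H1.le_one x hx'⟩ _ ⟨H2.sol.nn x hx', H2.le_one x hx'⟩
        rw [← mul_sub, Real.norm_eq_abs, abs_mul, abs_of_nonneg (sq_nonneg x)]
        have D : |u l1 x - u l2 x| ≤ f 1 * |l1 - l2| := by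
          rw [abs_of_nonpos (by linarith), abs_of_nonneg (by linarith : 0 ≤ l1 - l2)]
          linarith
        have E : |g (u l1 x) - g (u l2 x)| ≤ K * (f 1 * |l1 - l2|) :=
          C.trans (mul_le_mul_of_nonneg_left D hK0)
        have x2 : x ^ 2 ≤ 1 := by nlinarith [hx.1, hx.2]
        calc x ^ 2 * |g (u l1 x) - g (u l2 x)| ≤ 1 * |g (u l1 x) - g (u l2 x)| := by gcongr
          _ ≤ _ := by linarith)
    simpa using this
  have hGc : ContinuousOn G (Ioi 0) := by
    apply LipschitzOnWith.continuousOn (K := ⟨K * f 1, by positivity⟩)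
    apply LipschitzOnWith.of_dist_le_mul
    intro x hx y hy
    rw [Real.dist_eq, Real.dist_eq]
    change _ ≤ K * f 1 * _
    rcases le_total x y with h | h
    · rw [abs_sub_comm, abs_sub_comm x]; exact hdist y x hx h
    · exact hdist x y hy h
  -- positive somewhere
  have hpos : ∃ l ∈ Ioi (0:ℝ), 0 ≤ G l := by
    have hl : 0 < (1 - σc) / f 1 := div_pos (by linarith) hf1
    refine ⟨_, hl, ?_⟩
    obtain ⟨du1, h1, a1, H1⟩ := hu _ hl
    apply intervalIntegral.integral_nonneg zero_le_one
    intro x hx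
    have := small_lam hfm hf1 hl H1.sol x hx
    rw [div_mul_cancel₀ _ hf1.ne'] at this
    have h1 : σc ≤ u ((1 - σc) / f 1) x := by nlinarith [hx.1, hx.2, sq_nonneg x]
    have := hgm.monotoneOn (mem_Ici.mpr hσ0.le) (mem_Ici.mpr (hσ0.le.trans h1)) h1
    rw [hgσ] at this
    positivity
  have hneg : ∃ l ∈ Ioi (0:ℝ), G l ≤ 0 := by
    obtain ⟨ε, hε, hεσ⟩ := exists_between hσ0
    have hgε : g ε < 0 := by
      rw [← hgσ]; exact hgm (mem_Ici.mpr hε.le) (mem_Ici.mpr hσ0.le) hεσ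
    have hg1 : 0 < g 1 := by
      rw [← hgσ]; exact hgm (mem_Ici.mpr hσ0.le) (mem_Ici.mpr zero_le_one) hσ1
    set δ := min (1/2) (- g ε / (24 * g 1)) with hδ
    have hδ0 : 0 < δ := lt_min (by norm_num) (div_pos (by linarith) (by linarith))
    have hδ1 : δ ≤ 1 / 2 := min_le_left _ _
    have hδ2 : δ * (24 * g 1) ≤ - g ε := by
      rw [← le_div_iff₀ (by positivity)]; exact min_le_right _ _
    have hfε := hfp ε hε
    have hl : 0 < 8 / (f ε * δ ^ 2) := by positivity
    refine ⟨_, hl, ?_⟩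
    obtain ⟨du1, h1, a1, H1⟩ := hu _ hl
    have hρ := H1.large hfm hl hε hfε (ρ := 1 - δ) (by linarith) (by linarith) (by
      field_simp; ring)
    simp only [hG]
    set U := u (8 / (f ε * δ ^ 2))
    rw [← intervalIntegral.integral_add_adjacent_intervals
      (H1.gint hgc le_rfl (by linarith : 0 ≤ 1 - δ) (by linarith))
      (H1.gint hgc (by linarith : 0 ≤ 1 - δ) (by linarith) le_rfl)]
    have I1 : ∫ x in (0:ℝ)..(1 - δ), x ^ 2 * g (U x) ≤ ∫ x in (0:ℝ)..(1 - δ), x ^ 2 * g ε := by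
      apply intervalIntegral.integral_mono_on (by linarith)
        (H1.gint hgc le_rfl (by linarith : 0 ≤ 1 - δ) (by linarith))
        (Continuous.intervalIntegrable (by fun_prop) _ _)
      intro x hx
      have h3 : U x ≤ ε :=
        (H1.mono (mem_Ici.mpr hx.1) (mem_Ici.mpr (hx.1.trans hx.2)) hx.2).trans hρ
      have := hgm.monotoneOn (mem_Ici.mpr (H1.ha.le.trans (H1.lb x hx.1))) (mem_Ici.mpr hε.le) h3
      gcongr
    have I2 : ∫ x in (1 - δ)..1, x ^ 2 * g (U x) ≤ ∫ x in (1 - δ)..1, g 1 := by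
      apply intervalIntegral.integral_mono_on (by linarith)
        (H1.gint hgc (by linarith : 0 ≤ 1 - δ) (by linarith) le_rfl)
        (Continuous.intervalIntegrable (by fun_prop) _ _)
      intro x hx
      have hx' : x ∈ Icc (0:ℝ) 1 := ⟨by linarith [hx.1], hx.2⟩
      have := hgm.monotoneOn (mem_Ici.mpr (H1.sol.nn x hx')) (mem_Ici.mpr zero_le_one)
        (H1.le_one x hx')
      have x2 : x ^ 2 ≤ 1 := by nlinarith [hx'.1, hx'.2]
      nlinarith [sq_nonneg x]
    rw [intervalIntegral.integral_mul_const, integral_pow] at I1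
    rw [intervalIntegral.integral_const] at I2
    norm_num at I1 I2
    have h8 : (1 / 8 : ℝ) ≤ (1 - δ) ^ 3 := by
      have : (1 / 2 : ℝ) ^ 3 ≤ (1 - δ) ^ 3 := by gcongr; linarith
      linarith
    nlinarith
  obtain ⟨la, hla, hGa⟩ := hneg
  obtain ⟨lb, hlb, hGb⟩ := hpos
  obtain ⟨l, hl, hGl⟩ := isPreconnected_Ioi.intermediate_value hla hlb hGc ⟨hGa, hGb⟩
  obtain ⟨du1, h1, a1, H1⟩ := hu l hl
  exact ⟨l, hl, u l, du1, h1, a1, H1, hGl⟩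

lemma reg_of_C2 {F : ℝ → ℝ} (hF : ContDiffOn ℝ 2 F (Ioi 0)) (R : ℝ) :
    (∀ r ∈ Ioc (0:ℝ) R, HasDerivAt F (deriv F r) r) ∧
    (∀ r ∈ Ioc (0:ℝ) R, HasDerivAt (deriv F) (deriv (deriv F) r) r) ∧
    ContinuousOn (deriv F) (Ioc 0 R) ∧ ContinuousOn (deriv (deriv F)) (Ioc 0 R) := by
  have h1 : ContDiffOn ℝ 1 (deriv F) (Ioi 0) := hF.deriv_of_isOpen isOpen_Ioi (by norm_num)
  have h2 : ContinuousOn (deriv (deriv F)) (Ioi 0) :=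
    h1.continuousOn_deriv_of_isOpen isOpen_Ioi (by norm_num)
  refine ⟨fun r hr => ?_, fun r hr => ?_, h1.continuousOn.mono Ioc_subset_Ioi_self,
    h2.mono Ioc_subset_Ioi_self⟩
  · exact ((hF.differentiableOn (by norm_num)).differentiableAt (Ioi_mem_nhds hr.1)).hasDerivAt
  · exact ((h1.differentiableOn (by norm_num)).differentiableAt (Ioi_mem_nhds hr.1)).hasDerivAt

lemma C1_of {F F1 : ℝ → ℝ} (h : ∀ r, 0 < r → HasDerivAt F (F1 r) r)
    (hc : ContinuousOn F1 (Ioi 0)) : ContDiffOn ℝ 1 F (Ioi 0) := by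
  rw [show (1 : WithTop ℕ∞) = 0 + 1 from by norm_num, contDiffOn_succ_iff_deriv_of_isOpen isOpen_Ioi]
  refine ⟨fun r hr => (h r hr).differentiableAt.differentiableWithinAt, by simp, ?_⟩
  rw [contDiffOn_zero]
  exact hc.congr (fun r hr => (h r hr).deriv)

lemma C2_of {F F1 : ℝ → ℝ} (h : ∀ r, 0 < r → HasDerivAt F (F1 r) r)
    (hc : ContDiffOn ℝ 1 F1 (Ioi 0)) : ContDiffOn ℝ 2 F (Ioi 0) := by
  rw [show (2 : WithTop ℕ∞) = 1 + 1 from by norm_num, contDiffOn_succ_iff_deriv_of_isOpen isOpen_Ioi]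
  refine ⟨fun r hr => (h r hr).differentiableAt.differentiableWithinAt, by simp, ?_⟩
  exact hc.congr (fun r hr => (h r hr).deriv)

lemma rad_scale {f g : ℝ → ℝ} {γ R : ℝ} {σ v p : ℝ → ℝ} (hR : 0 < R)
    (H : IsRadialStationary f g γ R σ v p) :
    Sol f (R ^ 2) (fun x => σ (R * x)) (fun x => R * deriv σ (R * x)) ∧
    ContinuousOn (fun x => v (R * x) / R) (Icc 0 1) ∧ v (R * 1) / R = 0 ∧
    (∀ x ∈ Ioo (0:ℝ) 1, HasDerivAt (fun x => v (R * x) / R)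
      (g (σ (R * x)) - 2 / x * (v (R * x) / R)) x) := by
  obtain ⟨s1, s2, s3, s4, s5, s6, s7, s8, v1, v2, v3, v4, v5, v6, v7, v8, -⟩ := H
  have hmap : MapsTo (fun x => R * x) (Icc 0 1) (Icc 0 R) := fun x hx =>
    ⟨mul_nonneg hR.le hx.1, by nlinarith [hx.2]⟩
  have hmap2 : ∀ x ∈ Ioo (0:ℝ) 1, R * x ∈ Ioc 0 R := fun x hx =>
    ⟨mul_pos hR hx.1, by nlinarith [hx.2]⟩
  have hlin : ∀ x : ℝ, HasDerivAt (fun x => R * x) R x := fun x => by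
    simpa using (hasDerivAt_id x).const_mul R
  have hcl : ContinuousOn (fun x : ℝ => R * x) (Icc 0 1) := by fun_prop
  refine ⟨⟨s1.comp hcl hmap, ?_, ?_, ?_, by simpa using s8, ?_⟩,
    (v1.comp hcl hmap).div_const R, by simp [v8], ?_⟩
  · intro x hx
    exact ((s2 _ (hmap2 x hx)).comp x (hlin x)).congr_deriv (by ring)
  · intro x hx
    refine (((s3 _ (hmap2 x hx)).comp x (hlin x)).const_mul R).congr_deriv ?_
    have := (s6 _ (hmap2 x hx)).1
    rw [← this]
    have hx0 := hx.1.ne'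
    field_simp; ring
  · have h1 : Tendsto (fun x : ℝ => R * x) (nhdsWithin 0 (Ioi 0)) (nhdsWithin 0 (Ioi 0)) := by
      apply tendsto_nhdsWithin_iff.mpr ⟨?_, ?_⟩
      · have : Continuous (fun x : ℝ => R * x) := by fun_prop
        simpa using (this.tendsto 0).mono_left nhdsWithin_le_nhds
      · filter_upwards [self_mem_nhdsWithin] with x hx using mul_pos hR hx
    simpa using (s7.comp h1).const_mul R
  · intro x hx
    have hcl : closure (Ioc 0 R) = Icc 0 R := closure_Ioc hR.ne
    have := le_on_closure (f := fun _ => (0:ℝ)) (g := σ) (s := Ioc 0 R)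
      (fun r hr => (s6 r hr).2) continuousOn_const (by rw [hcl]; exact s1)
    exact this (by rw [hcl]; exact hmap hx)
  · intro x hx
    refine (((v2 _ (hmap2 x hx)).comp x (hlin x)).div_const R).congr_deriv ?_
    rw [← v6 _ (hmap2 x hx)]
    have hx0 := hx.1.ne'
    field_simp; ring

lemma rad_unique {f g : ℝ → ℝ} {γ R1 R2 : ℝ} {σ1 v1 p1 σ2 v2 p2 : ℝ → ℝ} (hR1 : 0 < R1)
    (hR2 : 0 < R2) (hf : StrictMonoOn f (Ici 0)) (hg : StrictMonoOn g (Ici 0))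
    (hf0 : f 0 = 0)
    (H1 : IsRadialStationary f g γ R1 σ1 v1 p1) (H2 : IsRadialStationary f g γ R2 σ2 v2 p2) :
    R1 = R2 ∧ ∀ r ∈ Icc (0:ℝ) R1, σ1 r = σ2 r := by
  wlog h : R2 ≤ R1 generalizing R1 R2 σ1 v1 p1 σ2 v2 p2
  · obtain ⟨a, b⟩ := this hR2 hR1 H2 H1 (le_of_not_ge h)
    subst a
    exact ⟨rfl, fun r hr => (b r hr).symm⟩
  obtain ⟨A1, B1, C1, D1⟩ := rad_scale hR1 H1
  obtain ⟨A2, B2, C2, D2⟩ := rad_scale hR2 H2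
  obtain ⟨a, b⟩ := A1.unique hf hg hf0 (by positivity) (by gcongr) A2 B1 B2 C1 C2 D1 D2
  have hR : R1 = R2 := (pow_left_inj₀ hR1.le hR2.le two_ne_zero).mp a
  subst hR
  refine ⟨rfl, fun r hr => ?_⟩
  have := b (r / R1) ⟨div_nonneg hr.1 hR1.le, (div_le_one hR1).mpr hr.2⟩
  simpa [mul_div_cancel₀ _ hR1.ne'] using this

lemma rad_exists {f g : ℝ → ℝ} (γ : ℝ) (hf : A1cond f) (hg : A2A3cond g) :
    ∃ R : ℝ, 0 < R ∧ ∃ σ v : ℝ → ℝ,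
      IsRadialStationary f g γ R σ v (fun r => γ / R + (4 / 3) * g (σ r)) := by
  obtain ⟨lam, hl, u, du, h, a, H, hint⟩ := exists_lam hf hg
  obtain ⟨hgs, hg', -⟩ := hg
  obtain ⟨R, hR, hRl⟩ : ∃ R : ℝ, 0 < R ∧ R ^ 2 = lam :=
    ⟨√lam, Real.sqrt_pos.mpr hl, Real.sq_sqrt hl.le⟩
  have hR0 := hR.ne'
  have hlin : ∀ x : ℝ, HasDerivAt (fun x => x / R) (1 / R) x := fun x =>
    (hasDerivAt_id x).div_const R
  set σ : ℝ → ℝ := fun r => u (r / R) with hσ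
  set dσ : ℝ → ℝ := fun r => du (r / R) / R with hdσ
  have huc := H.uc
  have hduc := H.duc
  have hhc := H.hc
  have σc : Continuous σ := by fun_prop
  have dσc : Continuous dσ := by fun_prop
  have σd : ∀ r, 0 < r → HasDerivAt σ (dσ r) r := fun r hr =>
    ((H.d1 _ (div_pos hr hR)).comp r (hlin r)).congr_deriv (by simp only [hdσ]; ring)
  have dσd : ∀ r, 0 < r → HasDerivAt dσ (h (r / R) - 2 / r * dσ r) r := fun r hr => by
    refine (((H.d2 _ (div_pos hr hR)).comp r (hlin r)).div_const R).congr_deriv ?_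
    have := hr.ne'
    simp only [hdσ, ← hRl]
    field_simp
  have dσ1 : ContDiffOn ℝ 1 dσ (Ioi 0) := C1_of dσd (by
    apply ContinuousOn.sub (by fun_prop)
    apply ContinuousOn.mul _ dσc.continuousOn
    exact continuousOn_const.div continuousOn_id (fun x hx => ne_of_gt hx))
  have σ2 : ContDiffOn ℝ 2 σ (Ioi 0) := C2_of σd dσ1
  have σpos : ∀ r, 0 ≤ r → 0 < σ r := fun r hr => H.ha.trans_le (H.lb _ (div_nonneg hr hR.le))
  have hgI : ContDiffOn ℝ (⊤ : ℕ∞) g (Ioi 0) := hgs.mono Ioi_subset_Ici_self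
  have gσ2 : ContDiffOn ℝ 2 (fun r => g (σ r)) (Ioi 0) :=
    (contDiffOn_infty.mp hgI 2).comp σ2 (fun r hr => σpos r (le_of_lt hr))
  set k : ℝ → ℝ := fun t => g (max (u t) 0) with hk
  have kc : Continuous k := hgs.continuousOn.comp_continuous (by fun_prop)
    (fun x => mem_Ici.mpr (le_max_right _ _))
  have kg : ∀ t, 0 ≤ t → k t = g (u t) := fun t ht => by
    simp only [hk]; rw [max_eq_left (H.ha.le.trans (H.lb t ht))]
  set v : ℝ → ℝ := fun r => R * Nop k (r / R) with hv
  have hNc := Nop_continuous kc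
  have vc : Continuous v := by fun_prop
  have vd : ∀ r, 0 < r → HasDerivAt v (g (σ r) - 2 / r * v r) r := fun r hr => by
    have hx := div_pos hr hR
    refine (((Nop_hasDerivAt kc hx.ne').comp r (hlin r)).const_mul R).congr_deriv ?_
    rw [kg _ hx.le]
    have := hr.ne'
    simp only [hv, hσ]
    field_simp
  have two_r : ContDiffOn ℝ 1 (fun r : ℝ => 2 / r) (Ioi 0) :=
    contDiffOn_const.div contDiffOn_id (fun x hx => ne_of_gt hx)
  have v1 : ContDiffOn ℝ 1 v (Ioi 0) := C1_of vd
    (gσ2.continuousOn.sub (two_r.continuousOn.mul vc.continuousOn))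
  have v2 : ContDiffOn ℝ 2 v (Ioi 0) := C2_of vd
    ((gσ2.of_le (by norm_num)).sub (two_r.mul v1))
  have p2 : ContDiffOn ℝ 2 (fun r => γ / R + (4 / 3) * g (σ r)) (Ioi 0) :=
    contDiffOn_const.add (contDiffOn_const.mul gσ2)
  have hV1 : Nop k 1 = 0 := by
    have : ∫ t in (0:ℝ)..1, t ^ 2 * k t = ∫ x in (0:ℝ)..1, x ^ 2 * g (u x) := by
      apply intervalIntegral.integral_congr
      intro t ht
      rw [uIcc_of_le zero_le_one] at ht
      simp only [kg t ht.1]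
    simp [Nop, this, hint]
  have hσR : σ R = 1 := by simp [hσ, hR0, H.one]
  have dσ0 : Tendsto dσ (nhdsWithin 0 (Ioi 0)) (nhds 0) := by
    have := (dσc.tendsto 0).mono_left (nhdsWithin_le_nhds (s := Ioi 0))
    simpa [hdσ, H.du0] using this
  obtain ⟨sa, sb, sc, sd⟩ := reg_of_C2 σ2 R
  obtain ⟨va, vb, vc', vd'⟩ := reg_of_C2 v2 R
  obtain ⟨pa, pb, pc, pd⟩ := reg_of_C2 p2 R
  refine ⟨R, hR, σ, v, σc.continuousOn, sa, sb, sc, sd, ?_, ?_, hσR, vc.continuousOn, va, vb,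
    vc', vd', ?_, ?_, ?_, ?_, pa, pb, pc, pd, ?_, ?_, ?_⟩
  · intro r hr
    refine ⟨?_, (σpos r hr.1.le).le⟩
    have e : deriv (deriv σ) r = deriv dσ r := by
      apply EventuallyEq.deriv_eq
      filter_upwards [Ioi_mem_nhds hr.1] with t ht using (σd t ht).deriv
    rw [e, (dσd r hr.1).deriv, (σd r hr.1).deriv,
      H.hh _ ⟨div_nonneg hr.1.le hR.le, (div_le_one hR).mpr hr.2⟩]
    simp only [hσ]; ring
  · refine dσ0.congr' ?_
    filter_upwards [self_mem_nhdsWithin] with t ht using (σd t ht).deriv.symm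
  · intro r hr
    rw [(vd r hr.1).deriv]; ring
  · simp [hv, Nop_zero]
  · simp [hv, hR0, hV1]
  · have : ContinuousOn (fun r => g (σ r)) (Icc 0 R) :=
      hgs.continuousOn.comp σc.continuousOn (fun r hr => (σpos r hr.1).le)
    exact continuousOn_const.add (continuousOn_const.mul this)
  · intro r hr
    simp
  · have hdg : ContinuousOn (deriv g) (Ioi 0) :=
      hgI.continuousOn_deriv_of_isOpen isOpen_Ioi (by simp)
    have c0 : ContinuousAt (deriv g) (σ 0) := hdg.continuousAt (Ioi_mem_nhds (σpos 0 le_rfl))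
    have t1 : Tendsto (fun r => deriv g (σ r)) (nhdsWithin 0 (Ioi 0)) (nhds (deriv g (σ 0))) :=
      c0.tendsto.comp ((σc.tendsto 0).mono_left nhdsWithin_le_nhds)
    have t2 := (t1.mul dσ0).const_mul (4 / 3)
    simp only [mul_zero] at t2
    refine t2.congr' ?_
    filter_upwards [self_mem_nhdsWithin] with t ht
    have hgd : HasDerivAt g (deriv g (σ t)) (σ t) :=
      (differentiableAt_of_deriv_ne_zero (hg' _ (σpos t (le_of_lt ht)).le).ne').hasDerivAt
    have := ((hgd.comp t (σd t ht)).const_mul (4 / 3)).const_add (γ / R)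
    exact this.deriv.symm
  · simp [hσR]

/-- **Theorem A.** Under Assumptions (A1)–(A3) and for any `γ > 0`, the radially
symmetric stationary problem has a unique solution `(R_s, σ_s, v_s, p_s)`; moreover
`p_s(r) = γ/R_s + (4/3) g(σ_s(r))` on `[0,R_s]`. -/
theorem radial_stationary_solution_exists_unique (f g : ℝ → ℝ) (γ : ℝ) (hγ : 0 < γ)
    (hf : A1cond f) (hg : A2A3cond g) :
    ∃ R : ℝ, 0 < R ∧ ∃ σ v p : ℝ → ℝ,
      IsRadialStationary f g γ R σ v p ∧
      (∀ r ∈ Icc (0:ℝ) R, p r = γ / R + (4 / 3) * g (σ r)) ∧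
      (∀ R' : ℝ, 0 < R' → ∀ σ' v' p' : ℝ → ℝ,
        IsRadialStationary f g γ R' σ' v' p' →
          R' = R ∧ ∀ r ∈ Icc (0:ℝ) R, σ' r = σ r ∧ v' r = v r ∧ p' r = p r) := by
  have hfm := smono hf.1 hf.2.2
  have hgm := smono hg.1 hg.2.1
  obtain ⟨R, hR, σ, v, H⟩ := rad_exists γ hf hg
  refine ⟨R, hR, σ, v, _, H, fun _ _ => rfl, ?_⟩
  intro R' hR' σ' v' p' H'
  obtain ⟨hRR, hσ⟩ := rad_unique hR' hR hfm hgm hf.2.1 H' H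
  subst hRR
  refine ⟨rfl, ?_⟩
  obtain ⟨-, -, -, -, -, -, -, -, v1, v2, -, -, -, v6, v7, v8, p1, p2, p3, -, -, -, p7, p8⟩ := H
  obtain ⟨-, -, -, -, -, -, -, -, w1, w2, -, -, -, w6, w7, w8, q1, q2, q3, -, -, q6, q7, q8⟩ := H'
  set p : ℝ → ℝ := fun r => γ / R' + (4 / 3) * g (σ r) with hp
  have hoc : ∀ r ∈ Ioo (0:ℝ) R', r ∈ Ioc (0:ℝ) R' := fun r hr => Ioo_subset_Ioc_self hr
  -- velocity
  have hv : ∀ r ∈ Ioo (0:ℝ) R', v' r - v r = 0 := by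
    apply zero_lemma (w := fun r => v' r - v r)
    · intro r hr
      refine ((w2 r (hoc r hr)).sub (v2 r (hoc r hr))).congr_deriv ?_
      have a := w6 r (hoc r hr)
      have b := v6 r (hoc r hr)
      rw [hσ r (Ioo_subset_Icc_self hr)] at a
      linear_combination a - b
    · have h0 : (0:ℝ) ∈ Icc 0 R' := left_mem_Icc.mpr hR'.le
      have c := (w1.sub v1) 0 h0
      have hle : nhdsWithin (0:ℝ) (Ioi 0) ≤ nhdsWithin 0 (Icc 0 R') := by
        rw [← nhdsWithin_Ioc_eq_nhdsGT hR']
        exact nhdsWithin_mono _ Ioc_subset_Icc_self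
      have := c.tendsto.mono_left hle
      have e : (v' - v) 0 = 0 := by simp [w7, v7]
      rw [e] at this
      exact this
  -- pressure
  have hdp : ∀ r ∈ Ioo (0:ℝ) R', deriv p' r - deriv p r = 0 := by
    apply zero_lemma (w := fun r => deriv p' r - deriv p r)
    · intro r hr
      refine ((q3 r (hoc r hr)).sub (p3 r (hoc r hr))).congr_deriv ?_
      have e1 : ∀ t ∈ Ioo (0:ℝ) R', deriv (fun s => p' s - (4 / 3) * g (σ' s)) t
          = deriv p' t - deriv p t := by
        intro t ht
        have : (fun s => p' s - (4 / 3) * g (σ' s)) =ᶠ[nhds t] fun s => p' s - p s + γ / R' := by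
          filter_upwards [Ioo_mem_nhds ht.1 ht.2] with s hs
          rw [hσ s (Ioo_subset_Icc_self hs)]
          simp only [hp]; ring
        rw [this.deriv_eq]
        exact (((q2 t (hoc t ht)).sub (p2 t (hoc t ht))).add_const _).deriv
      have e2 : deriv (deriv (fun s => p' s - (4 / 3) * g (σ' s))) r
          = deriv (deriv p') r - deriv (deriv p) r := by
        have : deriv (fun s => p' s - (4 / 3) * g (σ' s)) =ᶠ[nhds r]
            fun s => deriv p' s - deriv p s := by
          filter_upwards [Ioo_mem_nhds hr.1 hr.2] with s hs using e1 s hs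
        rw [this.deriv_eq]
        exact ((q3 r (hoc r hr)).sub (p3 r (hoc r hr))).deriv
      have := q6 r (hoc r hr)
      rw [e2, e1 r hr] at this
      linear_combination this
    · simpa using q7.sub p7
  intro r hr
  refine ⟨hσ r hr, ?_, ?_⟩
  · rcases eq_or_lt_of_le hr.1 with h | h
    · rw [← h, v7, w7]
    rcases eq_or_lt_of_le hr.2 with h' | h'
    · rw [h', v8, w8]
    exact sub_eq_zero.mp (hv r ⟨h, h'⟩)
  · rcases eq_or_lt_of_le hr.2 with h' | h'
    · rw [h', q8]; exact p8.symm
    obtain ⟨c, hc, hs⟩ := exists_hasDerivAt_eq_slope (fun r => p' r - p r)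
      (fun r => deriv p' r - deriv p r) h'
      ((q1.sub p1).mono (Icc_subset_Icc_left hr.1))
      (fun x hx => (q2 x ⟨hr.1.trans_lt hx.1, hx.2.le⟩).sub (p2 x ⟨hr.1.trans_lt hx.1, hx.2.le⟩))
    rw [hdp c ⟨hr.1.trans_lt hc.1, hc.2⟩, eq_comm, div_eq_zero_iff] at hs
    rcases hs with hs | hs
    · have : p' R' = p R' := by rw [q8]; exact p8.symm
      change p' r = p r
      linarith
    · linarith
end
end

section
/- Under Assumptions (A1)–(A3), the function σ_s satisfies 0 < σ_s(r) ≤ 1 for all r ∈ [0,1], σ_s'(r) > 0 for all 0 < r ≤ 1, and σ_s'(r) ≤ σ_s'(1) for all r ∈ (0,1]. In particular σ_s'(1) > 0. -/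
open Set Filter MeasureTheory

noncomputable section

theorem aux_mono (w w' : ℝ → ℝ) (hc : ContinuousOn w (Icc 0 1))
    (hd : ∀ r ∈ Ioo (0:ℝ) 1, HasDerivAt w (w' r) r) (hn : ∀ r ∈ Ioo (0:ℝ) 1, 0 ≤ w' r) :
    MonotoneOn w (Icc 0 1) := by
  apply monotoneOn_of_deriv_nonneg (convex_Icc 0 1) hc
  · rw [interior_Icc]
    exact fun r hr => (hd r hr).differentiableAt.differentiableWithinAt
  · rw [interior_Icc]
    intro r hr
    rw [(hd r hr).deriv]; exact hn r hr

/-- Under Assumptions (A1)–(A3): `0 < σ_s(r) ≤ 1` on `[0,1]`, `σ_s'(r) > 0` and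
`σ_s'(r) ≤ σ_s'(1)` on `(0,1]`; in particular `σ_s'(1) > 0`. -/
theorem sigma_s_monotone_bounds (f g σs : ℝ → ℝ)
    (hf : A1cond f) (hg : A2A3cond g) (hσ : SigmaS f σs) :
    (∀ r ∈ Icc (0:ℝ) 1, 0 < σs r ∧ σs r ≤ 1) ∧
    (∀ r ∈ Ioc (0:ℝ) 1, 0 < deriv σs r) ∧
    (∀ r ∈ Ioc (0:ℝ) 1, deriv σs r ≤ deriv σs 1) ∧
    0 < deriv σs 1 := by
  obtain ⟨hfs, hf0, hf'⟩ := hf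
  obtain ⟨hc, hd, hdd, hpc, -, hode, hnn, hlim, h1⟩ := hσ
  have hfd : ∀ x : ℝ, 0 ≤ x → HasDerivAt f (deriv f x) x := fun x hx =>
    (differentiableAt_of_deriv_ne_zero (hf' x hx).ne').hasDerivAt
  have hfc : ContinuousOn f (Ici 0) := fun x hx => (hfd x hx).continuousAt.continuousWithinAt
  have hfm : StrictMonoOn f (Ici 0) := by
    apply strictMonoOn_of_deriv_pos (convex_Ici 0) hfc
    rw [interior_Ici]
    exact fun x hx => hf' x (le_of_lt hx)
  have hs0 : 0 ≤ σs 0 := by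
    have h2 : Tendsto σs (nhdsWithin 0 (Ioo 0 1)) (nhds (σs 0)) :=
      (hc 0 (by simp)).mono_left (nhdsWithin_mono _ Ioo_subset_Icc_self)
    have : (nhdsWithin (0:ℝ) (Ioo 0 1)).NeBot := by
      rw [nhdsWithin_Ioo_eq_nhdsGT one_pos]; infer_instance
    refine ge_of_tendsto h2 ?_
    filter_upwards [self_mem_nhdsWithin] with r hr
    exact hnn r ⟨hr.1, hr.2.le⟩
  have hsnn : ∀ r ∈ Icc (0:ℝ) 1, 0 ≤ σs r := by
    intro r hr
    rcases hr.1.eq_or_lt with h | h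
    · rw [← h]; exact hs0
    · exact hnn r ⟨h, hr.2⟩
  have hfnn : ∀ x : ℝ, 0 ≤ x → 0 ≤ f x := by
    intro x hx
    have := hfm.monotoneOn (show (0:ℝ) ∈ Ici 0 by simp) hx hx
    rwa [hf0] at this
  have hwc : ContinuousOn (fun r => r ^ 2 * deriv σs r) (Icc 0 1) := by
    intro r hr
    rcases hr.1.eq_or_lt with h | h
    · subst h
      have h3 : ContinuousWithinAt (fun r : ℝ => r ^ 2 * deriv σs r) (Ioi 0) 0 := by
        have h4 : Tendsto (fun r : ℝ => r ^ 2) (nhdsWithin 0 (Ioi 0)) (nhds (0 ^ 2)) :=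
          ((continuous_pow 2).tendsto (0:ℝ)).mono_left nhdsWithin_le_nhds
        have := h4.mul hlim
        simpa [ContinuousWithinAt] using this
      have h5 := continuousWithinAt_insert_self.2 h3
      refine h5.mono ?_
      intro x hx
      rcases hx.1.eq_or_lt with h | h
      · left; exact h.symm
      · right; exact h
    · have := (hdd r ⟨h, hr.2⟩).continuousAt
      exact ((continuous_pow 2).continuousAt.mul this).continuousWithinAt
  have hwd : ∀ r ∈ Ioc (0:ℝ) 1,
      HasDerivAt (fun r => r ^ 2 * deriv σs r) (r ^ 2 * f (σs r)) r := by
    intro r hr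
    have h := ((hasDerivAt_id r).pow 2).mul (hdd r hr)
    have hr0 : r ≠ 0 := hr.1.ne'
    refine HasDerivAt.congr_deriv (show HasDerivAt (fun r => r ^ 2 * deriv σs r) _ r from h) ?_
    rw [← hode r hr]
    simp
    field_simp
    ring
  have hwm := aux_mono _ _ hwc (fun r hr => hwd r (Ioo_subset_Ioc_self hr))
    (fun r hr => mul_nonneg (sq_nonneg r) (hfnn _ (hsnn r (Ioo_subset_Icc_self hr))))
  have hpnn : ∀ r ∈ Ioc (0:ℝ) 1, 0 ≤ deriv σs r := by
    intro r hr
    have h := hwm (show (0:ℝ) ∈ Icc 0 1 by simp) (Ioc_subset_Icc_self hr) hr.1.le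
    simp only [ne_eq, OfNat.ofNat_ne_zero, not_false_eq_true, zero_pow, zero_mul] at h
    exact nonneg_of_mul_nonneg_right h (pow_pos hr.1 2)
  have hsm := aux_mono σs _ hc (fun r hr => hd r (Ioo_subset_Ioc_self hr))
    (fun r hr => hpnn r (Ioo_subset_Ioc_self hr))
  have hle1 : ∀ r ∈ Icc (0:ℝ) 1, σs r ≤ 1 := by
    intro r hr
    rw [← h1]; exact hsm hr (by simp) hr.2
  -- key bound
  have hkey : ∀ r ∈ Ioc (0:ℝ) 1, deriv σs r ≤ f (σs r) * r / 3 := by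
    have hm := aux_mono (fun r => f (σs r) * r ^ 3 - 3 * (r ^ 2 * deriv σs r))
      (fun r => deriv f (σs r) * deriv σs r * r ^ 3)
      (((hfc.comp hc hsnn).mul (continuous_pow 3).continuousOn).sub (hwc.const_mul 3)) ?_ ?_
    · intro r hr
      have h := hm (show (0:ℝ) ∈ Icc 0 1 by simp) (Ioc_subset_Icc_self hr) hr.1.le
      norm_num at h
      have h2 : 0 < r ^ 2 := pow_pos hr.1 2
      refine le_of_mul_le_mul_left ?_ h2
      linarith
    · intro r hr
      have hr' := Ioo_subset_Ioc_self hr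
      have ha := (hfd _ (hnn r hr')).comp r (hd r hr')
      have hb := (ha.mul ((hasDerivAt_id r).pow 3)).sub ((hwd r hr').const_mul 3)
      refine HasDerivAt.congr_deriv (show HasDerivAt (fun r => f (σs r) * r ^ 3 - 3 * (r ^ 2 * deriv σs r)) _ r from hb) ?_
      simp
      ring
    · intro r hr
      have hr' := Ioo_subset_Ioc_self hr
      exact mul_nonneg (mul_nonneg (hf' _ (hnn r hr')).le (hpnn r hr')) (pow_nonneg hr.1.le 3)
  obtain ⟨L, hL⟩ : ∃ L : ℝ, ∀ x ∈ Icc (0:ℝ) 1, f x ≤ L * x := by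
    have hds : ContinuousOn (dslope f 0) (Icc 0 1) := by
      intro x hx
      rcases hx.1.eq_or_lt with h | h
      · subst h
        exact (continuousAt_dslope_same.2 (hfd 0 le_rfl).differentiableAt).continuousWithinAt
      · exact ((continuousAt_dslope_of_ne h.ne').2 (hfd x hx.1).continuousAt).continuousWithinAt
    obtain ⟨L, hL⟩ := (isCompact_Icc.image_of_continuousOn hds).bddAbove
    refine ⟨L, fun x hx => ?_⟩
    have h2 := hL (mem_image_of_mem _ hx)
    have h3 := sub_smul_dslope f 0 x
    simp [hf0] at h3
    rw [← h3, mul_comm]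
    exact mul_le_mul_of_nonneg_right h2 hx.1
  have hs0pos : 0 < σs 0 := by
    have hm := aux_mono (fun r => -(σs r * Real.exp (-L * r)))
      (fun r => (L * σs r - deriv σs r) * Real.exp (-L * r)) ?_ ?_ ?_
    · have h := hm (show (0:ℝ) ∈ Icc 0 1 by simp) (show (1:ℝ) ∈ Icc 0 1 by simp) zero_le_one
      simp [h1] at h
      exact lt_of_lt_of_le (Real.exp_pos _) h
    · exact (hc.mul (by fun_prop)).neg
    · intro r hr
      have hr' := Ioo_subset_Ioc_self hr
      have he : HasDerivAt (fun r : ℝ => Real.exp (-L * r)) (Real.exp (-L * r) * (-L * 1)) r :=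
        ((hasDerivAt_id r).const_mul (-L)).exp
      refine HasDerivAt.congr_deriv (show HasDerivAt (fun r => -(σs r * Real.exp (-L * r))) _ r from ((hd r hr').mul he).neg) ?_
      ring
    · intro r hr
      have hr' := Ioo_subset_Ioc_self hr
      have hr'' := Ioo_subset_Icc_self hr
      refine mul_nonneg ?_ (Real.exp_pos _).le
      have h2 := hkey r hr'
      have h3 := hL (σs r) ⟨hnn r hr', hle1 r hr''⟩
      have h4 := hfnn _ (hnn r hr')
      nlinarith [hr.1, hr.2]
  have hspos : ∀ r ∈ Icc (0:ℝ) 1, 0 < σs r := fun r hr =>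
    hs0pos.trans_le (hsm (by simp) hr hr.1)
  have hfpos : ∀ x : ℝ, 0 < x → 0 < f x := by
    intro x hx
    have := hfm (show (0:ℝ) ∈ Ici 0 by simp) hx.le hx
    rwa [hf0] at this
  have hppos : ∀ r ∈ Ioc (0:ℝ) 1, 0 < deriv σs r := by
    have hsw : StrictMonoOn (fun r => r ^ 2 * deriv σs r) (Icc 0 1) := by
      apply strictMonoOn_of_deriv_pos (convex_Icc 0 1) hwc
      rw [interior_Icc]
      intro r hr
      rw [(hwd r (Ioo_subset_Ioc_self hr)).deriv]
      exact mul_pos (pow_pos hr.1 2) (hfpos _ (hspos r (Ioo_subset_Icc_self hr)))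
    intro r hr
    have h := hsw (show (0:ℝ) ∈ Icc 0 1 by simp) (Ioc_subset_Icc_self hr) hr.1
    simp only [ne_eq, OfNat.ofNat_ne_zero, not_false_eq_true, zero_pow, zero_mul] at h
    exact pos_of_mul_pos_right h (sq_nonneg r)
  have hpm : MonotoneOn (deriv σs) (Ioc 0 1) := by
    apply monotoneOn_of_deriv_nonneg (convex_Ioc 0 1) hpc
    · rw [interior_Ioc]
      exact fun r hr =>
        (hdd r (Ioo_subset_Ioc_self hr)).differentiableAt.differentiableWithinAt
    · rw [interior_Ioc]
      intro r hr
      have hr' := Ioo_subset_Ioc_self hr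
      have h2 := hkey r hr'
      have h3 := hode r hr'
      have h4 := hfnn _ (hnn r hr')
      have h5 : 2 / r * deriv σs r ≤ 2 / r * (f (σs r) * r / 3) :=
        mul_le_mul_of_nonneg_left h2 (div_nonneg zero_le_two hr.1.le)
      have h6 : 2 / r * (f (σs r) * r / 3) = 2 / 3 * f (σs r) := by
        have := hr.1.ne'
        field_simp
      linarith
  exact ⟨fun r hr => ⟨hspos r hr, hle1 r hr⟩, hppos,
    fun r hr => hpm hr (by simp) hr.2, hppos 1 (by simp)⟩
end
end

section
/- Under Assumptions (A1)–(A3), the function F_0 satisfies F_0(r) ≤ −σ_s'(r) ≤ 0 for all r ∈ [0,1]. -/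
open Set Filter MeasureTheory

noncomputable section

lemma maxp (w w' G' : ℝ → ℝ) (hc : ContinuousOn w (Icc 0 1))
    (hw : ∀ r ∈ Ioo (0:ℝ) 1, HasDerivAt w (w' r) r)
    (hG : ∀ r ∈ Ioo (0:ℝ) 1, HasDerivAt (fun r => r^2 * w' r) (G' r) r)
    (h0 : Tendsto (fun r => r^2 * w' r) (nhdsWithin 0 (Ioi 0)) (nhds 0))
    (hpos : ∀ r ∈ Ioo (0:ℝ) 1, 0 < w r → 0 < G' r) (h1 : w 1 ≤ 0) :
    ∀ r ∈ Icc (0:ℝ) 1, w r ≤ 0 := by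
  obtain ⟨m, hm, hmax⟩ := isCompact_Icc.exists_isMaxOn (nonempty_Icc.2 zero_le_one) hc
  intro r hr
  refine le_trans (hmax hr) ?_
  by_contra! hwm
  have hm1 : m < 1 := lt_of_le_of_ne hm.2 (by rintro rfl; linarith)
  -- G m = 0
  have hGm : m ^ 2 * w' m = 0 := by
    rcases eq_or_lt_of_le hm.1 with h | h
    · simp [← h]
    · have : IsLocalMax w m := hmax.isLocalMax (Icc_mem_nhds h hm1)
      rw [this.hasDerivAt_eq_zero (hw m ⟨h, hm1⟩)]; simp
  have hGc : ContinuousOn (fun r => r^2 * w' r) (Ico m 1) := by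
    intro s hs
    rcases eq_or_lt_of_le (hm.1.trans hs.1) with h | h
    · have hm0 : m = 0 := le_antisymm (h ▸ hs.1) hm.1
      subst hm0
      subst h
      have : ContinuousWithinAt (fun r => r^2 * w' r) (Ici 0) 0 := by
        rw [← continuousWithinAt_Ioi_iff_Ici]
        simpa [ContinuousWithinAt] using h0
      exact this.mono Ico_subset_Ici_self
    · exact (hG s ⟨h, hs.2⟩).continuousAt.continuousWithinAt
  have hev : ∀ᶠ s in nhdsWithin m (Ici m), 0 < w s := by
    have : ContinuousWithinAt w (Ico m 1) m :=
      (hc m hm).mono (fun x hx => ⟨hm.1.trans hx.1, hx.2.le⟩)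
    have h2 : ContinuousWithinAt w (Ici m) m :=
      this.mono_of_mem_nhdsWithin (Ico_mem_nhdsGE hm1)
    exact h2.eventually (lt_mem_nhds hwm)
  obtain ⟨u, hu, hsub⟩ := (mem_nhdsGE_iff_exists_Icc_subset).1 hev
  set v := min u ((m+1)/2) with hv
  have hmv : m < v := lt_min hu (by linarith)
  have hv1 : v < 1 := lt_of_le_of_lt (min_le_right _ _) (by linarith)
  have hwpos : ∀ s ∈ Icc m v, 0 < w s := fun s hs => hsub ⟨hs.1, hs.2.trans (min_le_left _ _)⟩
  have hin : ∀ s ∈ Ioo m v, s ∈ Ioo (0:ℝ) 1 := fun s hs =>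
    ⟨hm.1.trans_lt hs.1, hs.2.trans hv1⟩
  have hmono : StrictMonoOn (fun r => r^2 * w' r) (Icc m v) := by
    apply strictMonoOn_of_deriv_pos (convex_Icc _ _)
    · exact hGc.mono (fun x hx => ⟨hx.1, hx.2.trans_lt hv1⟩)
    · intro s hs
      rw [interior_Icc] at hs
      rw [(hG s (hin s hs)).deriv]
      exact hpos s (hin s hs) (hwpos s ⟨hs.1.le, hs.2.le⟩)
  have hmono2 : StrictMonoOn w (Icc m v) := by
    apply strictMonoOn_of_deriv_pos (convex_Icc _ _)
    · exact hc.mono (fun x hx => ⟨hm.1.trans hx.1, hx.2.trans hv1.le⟩)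
    · intro s hs
      rw [interior_Icc] at hs
      rw [(hw s (hin s hs)).deriv]
      have := hmono (left_mem_Icc.2 hmv.le) ⟨hs.1.le, hs.2.le⟩ hs.1
      simp only [hGm] at this
      exact pos_of_mul_pos_right this (sq_nonneg s)
  have h3 := hmono2 (left_mem_Icc.2 hmv.le) (right_mem_Icc.2 hmv.le) hmv
  have h4 : w v ≤ w m := hmax ⟨hm.1.trans hmv.le, hv1.le⟩
  linarith

/-- Under Assumptions (A1)–(A3): `F₀(r) ≤ -σ_s'(r) ≤ 0` on `[0,1]` (at `r = 0` the
value `-σ_s'(0)` is understood as the limit `0`, so the claim there is `F₀(0) ≤ 0`). -/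
theorem F0_le_neg_deriv_sigma_s (f g σs F0 : ℝ → ℝ)
    (hf : A1cond f) (hg : A2A3cond g) (hσ : SigmaS f σs) (hF : RadF f σs 0 F0) :
    (∀ r ∈ Ioc (0:ℝ) 1, F0 r ≤ -deriv σs r ∧ -deriv σs r ≤ 0) ∧ F0 0 ≤ 0 := by
  obtain ⟨hfc, hf0, hfd⟩ := hf
  obtain ⟨sc, sd, sdd, sdc, -, sode, snn, slim, s1⟩ := hσ
  obtain ⟨Fc, Fd, Fdd, -, -, Fode, Flim, F1⟩ := hF
  have hfD : ∀ x, 0 ≤ x → HasDerivAt f (deriv f x) x := fun x hx =>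
    (differentiableAt_of_deriv_ne_zero (hfd x hx).ne').hasDerivAt
  have hfnn : ∀ x, 0 ≤ x → 0 ≤ f x := by
    have : MonotoneOn f (Ici 0) := by
      apply monotoneOn_of_deriv_nonneg (convex_Ici 0) hfc.continuousOn
      · intro x hx
        exact (hfD x (interior_subset hx)).differentiableAt.differentiableWithinAt
      · intro x hx
        exact (hfd x (interior_subset hx)).le
    intro x hx
    rw [← hf0]
    exact this (mem_Ici.2 le_rfl) hx hx
  have hid : Tendsto (fun r : ℝ => r) (nhdsWithin 0 (Ioi 0)) (nhds 0) :=
    tendsto_nhdsWithin_of_tendsto_nhds tendsto_id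
  -- sign of the derivative
  have hp : ∀ r ∈ Ioc (0:ℝ) 1, 0 ≤ deriv σs r := by
    have hd : ∀ r ∈ Ioc (0:ℝ) 1,
        HasDerivAt (fun r => r^2 * deriv σs r) (r^2 * f (σs r)) r := by
      intro r hr
      have h := (hasDerivAt_pow 2 r).mul (sdd r hr)
      refine HasDerivAt.congr_deriv h ?_
      rw [← sode r hr]
      have := hr.1.ne'
      field_simp
      push_cast
      ring
    have hmono : MonotoneOn (fun r => r^2 * deriv σs r) (Ioc 0 1) := by
      apply monotoneOn_of_deriv_nonneg (convex_Ioc 0 1)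
      · exact fun r hr => (hd r hr).continuousAt.continuousWithinAt
      · exact fun r hr =>
          (hd r (interior_subset hr)).differentiableAt.differentiableWithinAt
      · intro r hr
        rw [(hd r (interior_subset hr)).deriv]
        exact mul_nonneg (sq_nonneg _) (hfnn _ (snn r (interior_subset hr)))
    intro r hr
    have hl : Tendsto (fun r => r^2 * deriv σs r) (nhdsWithin 0 (Ioi 0)) (nhds 0) := by
      simpa using (hid.pow 2).mul slim
    have : 0 ≤ r^2 * deriv σs r := by
      apply le_of_tendsto hl
      filter_upwards [Ioc_mem_nhdsGT hr.1] with s hs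
      exact hmono ⟨hs.1, hs.2.trans hr.2⟩ hr hs.2
    exact nonneg_of_mul_nonneg_right this (pow_pos hr.1 2)
  have hσlim : Tendsto σs (nhdsWithin 0 (Ioi 0)) (nhds (σs 0)) := by
    have : ContinuousWithinAt σs (Ioc 0 1) 0 :=
      (sc 0 ⟨le_rfl, zero_le_one⟩).mono Ioc_subset_Icc_self
    exact this.mono_of_mem_nhdsWithin (Ioc_mem_nhdsGT zero_lt_one)
  have hσ0 : 0 ≤ σs 0 := by
    apply ge_of_tendsto hσlim
    filter_upwards [Ioc_mem_nhdsGT (zero_lt_one (α := ℝ))] with s hs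
    exact snn s hs
  have hflim : Tendsto (fun r => f (σs r)) (nhdsWithin 0 (Ioi 0)) (nhds (f (σs 0))) :=
    (hfD _ hσ0).continuousAt.tendsto.comp hσlim
  set P := Function.update (deriv σs) 0 0 with hP
  have hPe : ∀ r : ℝ, 0 < r → P r = deriv σs r := fun r hr => by simp [hP, hr.ne']
  have hPc : ContinuousOn P (Icc 0 1) := by
    rw [hP, continuousOn_update_iff]
    constructor
    · exact sdc.mono (fun x hx => ⟨lt_of_le_of_ne hx.1.1 (fun h => hx.2 h.symm), hx.1.2⟩)
    · intro _
      exact slim.mono_left (nhdsWithin_mono _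
        (fun x hx => lt_of_le_of_ne hx.1.1 (fun h => hx.2 h.symm)))
  have key := maxp (fun r => F0 r + P r)
    (fun r => deriv F0 r + deriv (deriv σs) r)
    (fun r => r^2 * deriv f (σs r) * (F0 r + P r) + 2 * P r)
    (Fc.add hPc) ?_ ?_ ?_ ?_ ?_
  · refine ⟨fun r hr => ⟨?_, by linarith [hp r hr]⟩, ?_⟩
    · have := key r ⟨hr.1.le, hr.2⟩
      simp only [hPe r hr.1] at this
      linarith
    · have := key 0 ⟨le_rfl, zero_le_one⟩
      simpa [hP] using this
  · intro r hr
    refine (Fd r hr).add ((sdd r ⟨hr.1, hr.2.le⟩).congr_of_eventuallyEq ?_)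
    filter_upwards [Ioi_mem_nhds hr.1] with s hs using hPe s hs
  · intro r hr
    have hr' : r ∈ Ioc (0:ℝ) 1 := ⟨hr.1, hr.2.le⟩
    have h1 : HasDerivAt (fun r => r^2 * deriv F0 r + r^2 * f (σs r) - 2 * r * deriv σs r)
        (r^2 * deriv f (σs r) * (F0 r + P r) + 2 * P r) r := by
      have h := (((hasDerivAt_pow 2 r).mul (Fdd r hr)).add
        ((hasDerivAt_pow 2 r).mul ((hfD _ (snn r hr')).comp r (sd r hr')))).sub
        (((hasDerivAt_id r).const_mul 2).mul (sdd r hr'))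
      refine HasDerivAt.congr_deriv h ?_
      have e1 := Fode r hr
      have e2 := sode r hr'
      have hr0 := hr.1.ne'
      have e1' : deriv (deriv F0) r = deriv f (σs r) * F0 r - 2 / r * deriv F0 r := by
        simp at e1; linarith
      have e2' : deriv (deriv σs) r = f (σs r) - 2 / r * deriv σs r := by linarith
      rw [e1', e2', hPe r hr.1]
      simp
      field_simp
      ring
    refine h1.congr_of_eventuallyEq ?_
    filter_upwards [Ioo_mem_nhds hr.1 hr.2] with s hs
    have e2 := sode s ⟨hs.1, hs.2.le⟩
    have := hs.1.ne'
    rw [← e2]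
    field_simp
    ring
  · have h : Tendsto (fun r => r^2 * deriv F0 r + r^2 * f (σs r) - 2 * r * deriv σs r)
        (nhdsWithin 0 (Ioi 0)) (nhds 0) := by
      simpa using (((hid.pow 2).mul Flim).add ((hid.pow 2).mul hflim)).sub
        ((hid.const_mul 2).mul slim)
    refine h.congr' ?_
    filter_upwards [Ioc_mem_nhdsGT (zero_lt_one (α := ℝ))] with s hs
    have e2 := sode s hs
    have := hs.1.ne'
    rw [← e2]
    field_simp
    ring
  · intro r hr hw
    have hr' : r ∈ Ioc (0:ℝ) 1 := ⟨hr.1, hr.2.le⟩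
    have h1 : 0 < r^2 * deriv f (σs r) := mul_pos (pow_pos hr.1 2) (hfd _ (snn r hr'))
    have h2 := mul_pos h1 hw
    have h3 := hp r hr'
    rw [← hPe r hr.1] at h3
    beta_reduce at h2 ⊢
    linarith
  · simp [hPe 1 one_pos, F1]
end
end

section
/- Under Assumptions (A1)–(A3) and the normalization ∫₀¹ g(σ_s(r)) r² dr = 0, the number α_0 := g(1) + ∫₀¹ g'(σ_s(r)) F_0(r) r² dr satisfies α_0 ≤ 2∫₀¹ g(σ_s(r)) r dr < 0; in particular α_0 < 0. (Lemma 3.4(i).) -/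
open Set Filter MeasureTheory

noncomputable section

lemma no_max_aux (u u1 : ℝ → ℝ) (c d : ℝ) (h1 : ∀ᶠ x in nhds c, HasDerivAt u (u1 x) x)
    (h2 : HasDerivAt u1 d c) (hd : 0 < d) (hmax : IsLocalMax u c) : False := by
  have e1 : deriv u =ᶠ[nhds c] u1 := h1.mono fun x hx => hx.deriv
  have e2 : deriv (deriv u) c = d := by rw [e1.deriv_eq, h2.deriv]
  have hmin : IsLocalMin u c :=
    isLocalMin_of_deriv_deriv_pos (by rw [e2]; exact hd) hmax.deriv_eq_zero
      h1.self_of_nhds.continuousAt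
  have hc : u =ᶠ[nhds c] fun _ => u c := by
    filter_upwards [hmax, hmin] with x a b
    exact le_antisymm a b
  have e3 : deriv u =ᶠ[nhds c] fun _ => 0 := by
    have := hc.deriv
    simpa using this
  have : deriv (deriv u) c = 0 := by rw [e3.deriv_eq]; simp
  linarith

/-- maximum principle: positive max is impossible -/
lemma max_aux (u : ℝ → ℝ) (hc : ContinuousOn u (Icc 0 1)) (h1 : u 1 ≤ 0)
    (h0 : 0 < u 0 → ∃ x ∈ Icc (0:ℝ) 1, u 0 < u x)
    (hi : ∀ c ∈ Ioo (0:ℝ) 1, 0 < u c → IsLocalMax u c → False) :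
    ∀ r ∈ Icc (0:ℝ) 1, u r ≤ 0 := by
  obtain ⟨c, hcI, hm⟩ := isCompact_Icc.exists_isMaxOn (nonempty_Icc.2 zero_le_one) hc
  intro r hr
  refine (hm hr).trans ?_
  by_contra! hpos
  rcases eq_or_lt_of_le hcI.1 with h | h
  · subst h
    obtain ⟨x, hx, hlt⟩ := h0 hpos
    exact absurd (hm hx) (not_le.2 hlt)
  rcases eq_or_lt_of_le hcI.2 with h' | h'
  · subst h'; linarith
  exact hi c ⟨h, h'⟩ hpos (hm.isLocalMax (Icc_mem_nhds h h'))

lemma upd_cont (v : ℝ → ℝ) (s : Set ℝ) (hs : s ⊆ Ici 0) (h0 : Tendsto v (nhdsWithin 0 (Ioi 0)) (nhds 0))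
    (hc : ∀ x ∈ s, 0 < x → ContinuousAt v x) :
    ContinuousOn (Function.update v 0 0) s := by
  intro x hx
  rcases eq_or_lt_of_le (mem_Ici.1 (hs hx)) with h | h
  · subst h
    rw [continuousWithinAt_update_same]
    refine h0.mono_left (nhdsWithin_mono _ ?_)
    intro y hy
    exact lt_of_le_of_ne (hs hy.1) (Ne.symm hy.2)
  · exact ((continuousAt_update_of_ne h.ne').2 (hc x hx h)).continuousWithinAt

lemma derivAt_upd (v : ℝ → ℝ) (d x : ℝ) (hx : 0 < x) (h : HasDerivAt v d x) :
    HasDerivAt (Function.update v 0 0) d x := by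
  refine h.congr_of_eventuallyEq ?_
  filter_upwards [lt_mem_nhds hx] with y hy
  exact Function.update_of_ne hy.ne' _ _

lemma deriv_cont_aux (g : ℝ → ℝ) (h : ContDiffOn ℝ (⊤ : ℕ∞) g (Ici 0))
    (hp : ∀ σ : ℝ, 0 ≤ σ → 0 < deriv g σ) : ContinuousOn (deriv g) (Ici 0) := by
  have := h.continuousOn_derivWithin (uniqueDiffOn_Ici 0) (by simp)
  refine this.congr fun x hx => ?_
  exact ((differentiableAt_of_deriv_ne_zero (hp x hx).ne').derivWithin
    (uniqueDiffOn_Ici 0 x hx)).symm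

lemma strictMono_aux (g : ℝ → ℝ) (h : ContDiffOn ℝ (⊤ : ℕ∞) g (Ici 0))
    (hp : ∀ σ : ℝ, 0 ≤ σ → 0 < deriv g σ) : StrictMonoOn g (Ici 0) := by
  refine strictMonoOn_of_deriv_pos (convex_Ici 0) h.continuousOn fun x hx => hp x ?_
  exact interior_subset hx

/-- Lemma 3.4(i): under Assumptions (A1)–(A3) and the normalization
`∫₀¹ g(σ_s(r)) r² dr = 0`, the eigenvalue
`α₀ = g(1) + ∫₀¹ g'(σ_s(r)) F₀(r) r² dr` satisfies
`α₀ ≤ 2 ∫₀¹ g(σ_s(r)) r dr < 0`; in particular `α₀ < 0`. -/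
theorem alpha0_neg (f g σs F0 : ℝ → ℝ)
    (hf : A1cond f) (hg : A2A3cond g) (hσ : SigmaS f σs) (hF : RadF f σs 0 F0)
    (hnorm : (∫ r in (0:ℝ)..1, g (σs r) * r ^ 2) = 0) :
    g 1 + (∫ r in (0:ℝ)..1, deriv g (σs r) * F0 r * r ^ 2)
        ≤ 2 * ∫ r in (0:ℝ)..1, g (σs r) * r ∧
    2 * (∫ r in (0:ℝ)..1, g (σs r) * r) < 0 ∧
    g 1 + (∫ r in (0:ℝ)..1, deriv g (σs r) * F0 r * r ^ 2) < 0 := by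
  obtain ⟨hfs, hf0, hfp⟩ := hf
  obtain ⟨hgs, hgp, σc, hσc0, hσc1, hgσc⟩ := hg
  obtain ⟨sc, sd1, sd2, -, -, sode, snn, slim, s1⟩ := hσ
  obtain ⟨Fc, Fd1, Fd2, -, -, Fode, Flim, F1⟩ := hF
  have fmono := strictMono_aux f hfs hfp
  have gmono := strictMono_aux g hgs hgp
  have gdc := deriv_cont_aux g hgs hgp
  -- nonnegativity at 0
  have snn' : ∀ r ∈ Icc (0:ℝ) 1, 0 ≤ σs r := by
    have hcl : Icc (0:ℝ) 1 ⊆ closure (Ioc 0 1) := by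
      rw [closure_Ioc zero_ne_one]
    intro r hr
    have hcw : ContinuousWithinAt σs (Ioc 0 1) r := (sc r hr).mono Ioc_subset_Icc_self
    have hne : (nhdsWithin r (Ioc (0:ℝ) 1)).NeBot := mem_closure_iff_nhdsWithin_neBot.1 (hcl hr)
    exact ge_of_tendsto hcw (eventually_nhdsWithin_of_forall snn)
  have hfnn : ∀ r ∈ Icc (0:ℝ) 1, 0 ≤ f (σs r) := fun r hr => by
    have := fmono.monotoneOn (mem_Ici.2 le_rfl) (mem_Ici.2 (snn' r hr)) (snn' r hr)
    linarith
  -- the extended derivatives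
  set w : ℝ → ℝ := Function.update (deriv σs) 0 0 with hw
  have w0 : w 0 = 0 := by simp [hw]
  have wr : ∀ r, 0 < r → w r = deriv σs r := fun r hr => Function.update_of_ne hr.ne' _ _
  have wc : ContinuousOn w (Icc 0 1) := upd_cont _ _ (fun x hx => hx.1) slim
    fun x hx h => (sd2 x ⟨h, hx.2⟩).continuousAt
  have wd : ∀ r ∈ Ioc (0:ℝ) 1, HasDerivAt w (deriv (deriv σs) r) r := fun r hr =>
    derivAt_upd _ _ _ hr.1 (sd2 r hr)
  have wnn : ∀ r ∈ Icc (0:ℝ) 1, 0 ≤ w r := by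
    have hd : ∀ r ∈ Ioo (0:ℝ) 1, HasDerivAt (fun r => r ^ 2 * w r) (r ^ 2 * f (σs r)) r := by
      intro r hr
      have h := ((hasDerivAt_id r).pow 2).mul (wd r ⟨hr.1, hr.2.le⟩)
      refine HasDerivAt.congr_deriv h ?_
      have h0 := hr.1.ne'
      rw [← sode r ⟨hr.1, hr.2.le⟩, wr r hr.1]
      simp
      field_simp
      ring
    have hm : MonotoneOn (fun r => r ^ 2 * w r) (Icc 0 1) := by
      refine monotoneOn_of_deriv_nonneg (convex_Icc 0 1) (by fun_prop) ?_ ?_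
      · rw [interior_Icc]
        exact fun r hr => (hd r hr).differentiableAt.differentiableWithinAt
      · rw [interior_Icc]
        intro r hr
        rw [(hd r hr).deriv]
        exact mul_nonneg (sq_nonneg _) (hfnn r ⟨hr.1.le, hr.2.le⟩)
    intro r hr
    rcases eq_or_lt_of_le hr.1 with h | h
    · rw [← h, w0]
    · have := hm (left_mem_Icc.2 zero_le_one) hr hr.1
      simp only [w0, mul_zero] at this
      exact nonneg_of_mul_nonneg_right this (by positivity)
  have smono : MonotoneOn σs (Icc 0 1) := by
    refine monotoneOn_of_deriv_nonneg (convex_Icc 0 1) sc ?_ ?_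
    · rw [interior_Icc]
      exact fun r hr => (sd1 r ⟨hr.1, hr.2.le⟩).differentiableAt.differentiableWithinAt
    · rw [interior_Icc]
      intro r hr
      rw [← wr r hr.1]
      exact wnn r ⟨hr.1.le, hr.2.le⟩
  have w1 : w 1 = deriv σs 1 := wr 1 one_pos
  -- F0 ≤ 0
  have Fnp : ∀ r ∈ Icc (0:ℝ) 1, F0 r ≤ 0 := by
    apply max_aux F0 Fc
    · rw [F1, ← w1]; linarith [wnn 1 (by simp)]
    · intro hpos
      have hev : ∀ᶠ x in nhdsWithin 0 (Icc (0:ℝ) 1), 0 < F0 x :=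
        (Fc 0 (by simp)).eventually (lt_mem_nhds hpos)
      rw [eventually_nhdsWithin_iff, Metric.eventually_nhds_iff] at hev
      obtain ⟨e, he, hev⟩ := hev
      set b := min (e / 2) (1 / 2) with hb
      have hb0 : 0 < b := by positivity
      have hb1 : b < 1 := lt_of_le_of_lt (min_le_right _ _) (by norm_num)
      have hbe : b < e := lt_of_le_of_lt (min_le_left _ _) (by linarith)
      have Fp : ∀ x ∈ Icc 0 b, 0 < F0 x := fun x hx => by
        refine hev ?_ ⟨hx.1, hx.2.trans hb1.le⟩
        rw [Real.dist_eq, sub_zero, abs_of_nonneg hx.1]; linarith [hx.2]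
      set v : ℝ → ℝ := Function.update (deriv F0) 0 0 with hv
      have v0 : v 0 = 0 := by simp [hv]
      have vr : ∀ r, 0 < r → v r = deriv F0 r := fun r hr => Function.update_of_ne hr.ne' _ _
      have vc : ContinuousOn v (Icc 0 b) := upd_cont _ _ (fun x hx => hx.1) Flim
        fun x hx h => (Fd2 x ⟨h, hx.2.trans_lt hb1⟩).continuousAt
      have vd : ∀ r ∈ Ioo (0:ℝ) b, HasDerivAt (fun r => r ^ 2 * v r)
          (r ^ 2 * (deriv f (σs r) * F0 r)) r := by
        intro r hr
        have hr1 : r ∈ Ioo (0:ℝ) 1 := ⟨hr.1, hr.2.trans hb1⟩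
        have h := ((hasDerivAt_id r).pow 2).mul (derivAt_upd _ _ _ hr.1 (Fd2 r hr1))
        refine HasDerivAt.congr_deriv h ?_
        have h0 := hr.1.ne'
        rw [← Fode r hr1, ← hv, vr r hr.1]
        simp
        field_simp
        ring
      have hm : StrictMonoOn (fun r => r ^ 2 * v r) (Icc 0 b) := by
        refine strictMonoOn_of_deriv_pos (convex_Icc 0 b) (by fun_prop) ?_
        rw [interior_Icc]
        intro r hr
        rw [(vd r hr).deriv]
        have h1 := Fp r ⟨hr.1.le, hr.2.le⟩
        have h2 := hfp (σs r) (snn' r ⟨hr.1.le, (hr.2.trans hb1).le⟩)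
        have h3 := hr.1
        positivity
      have hFm : StrictMonoOn F0 (Icc 0 b) := by
        refine strictMonoOn_of_deriv_pos (convex_Icc 0 b)
          (Fc.mono (Icc_subset_Icc le_rfl hb1.le)) ?_
        rw [interior_Icc]
        intro r hr
        have := hm (left_mem_Icc.2 hb0.le) ⟨hr.1.le, hr.2.le⟩ hr.1
        simp only [v0, mul_zero] at this
        rw [vr r hr.1] at this
        exact pos_of_mul_pos_right this (by positivity)
      exact ⟨b, ⟨hb0.le, hb1.le⟩, hFm (left_mem_Icc.2 hb0.le) (right_mem_Icc.2 hb0.le) hb0⟩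
    · intro c hc hpos hmax
      refine no_max_aux F0 (deriv F0) c _ ?_ (Fd2 c hc) ?_ hmax
      · filter_upwards [Ioo_mem_nhds hc.1 hc.2] with x hx using Fd1 x hx
      · have h := Fode c hc
        rw [hmax.deriv_eq_zero] at h
        have h2 := mul_pos (hfp (σs c) (snn' c ⟨hc.1.le, hc.2.le⟩)) hpos
        simp at h
        linarith
  -- F0 + w ≤ 0
  have unp : ∀ r ∈ Icc (0:ℝ) 1, F0 r + w r ≤ 0 := by
    apply max_aux (fun r => F0 r + w r) (Fc.add wc)
    · simp only [F1, w1]; linarith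
    · intro hpos
      simp only [w0] at hpos
      linarith [Fnp 0 (by simp)]
    · intro c hc hpos hmax
      have hd1 : ∀ x ∈ Ioo (0:ℝ) 1,
          HasDerivAt (fun r => F0 r + w r) (deriv F0 x + deriv (deriv σs) x) x :=
        fun x hx => (Fd1 x hx).add (wd x ⟨hx.1, hx.2.le⟩)
      have hcc : c ∈ Ioc (0:ℝ) 1 := ⟨hc.1, hc.2.le⟩
      have hnn := snn c hcc
      have hs3 : HasDerivAt (deriv (deriv σs))
          (deriv f (σs c) * deriv σs c - (-(2 / c ^ 2) * deriv σs c
            + 2 / c * deriv (deriv σs) c)) c := by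
        have hff : HasDerivAt f (deriv f (σs c)) (σs c) :=
          (differentiableAt_of_deriv_ne_zero (hfp _ hnn).ne').hasDerivAt
        have hinv : HasDerivAt (fun r : ℝ => 2 / r) (-(2 / c ^ 2)) c := by
          have := (hasDerivAt_inv hc.1.ne').const_mul (2:ℝ)
          simp only [div_eq_mul_inv]
          refine HasDerivAt.congr_deriv this ?_
          ring
        have h := (hff.comp c (sd1 c hcc)).sub (hinv.mul (sd2 c hcc))
        refine h.congr_of_eventuallyEq ?_
        filter_upwards [Ioo_mem_nhds hc.1 hc.2] with x hx
        have := sode x ⟨hx.1, hx.2.le⟩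
        simp
        linarith
      have hz : deriv F0 c + deriv (deriv σs) c = 0 := by
        rw [← (hd1 c hc).deriv]; exact hmax.deriv_eq_zero
      refine no_max_aux _ (fun x => deriv F0 x + deriv (deriv σs) x) c _ ?_
        ((Fd2 c hc).add hs3) ?_ hmax
      · filter_upwards [Ioo_mem_nhds hc.1 hc.2] with x hx using hd1 x hx
      · have h := Fode c hc
        simp at h
        have h2 := mul_pos (hfp (σs c) hnn) hpos
        have h3 : 0 ≤ 2 / c ^ 2 * deriv σs c := by
          rw [← wr c hc.1]
          exact mul_nonneg (by positivity) (wnn c ⟨hc.1.le, hc.2.le⟩)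
        rw [wr c hc.1] at h2
        have h4 : 2 / c * (deriv F0 c + deriv (deriv σs) c) = 0 := by rw [hz, mul_zero]
        linarith
  -- integrals
  have hmaps : MapsTo σs (Icc 0 1) (Ici 0) := fun r hr => snn' r hr
  have hc : ContinuousOn (fun r => g (σs r)) (Icc 0 1) := hgs.continuousOn.comp sc hmaps
  have hdc : ContinuousOn (fun r => deriv g (σs r)) (Icc 0 1) := gdc.comp sc hmaps
  have hmono : MonotoneOn (fun r => g (σs r)) (Icc 0 1) := fun x hx y hy hxy =>
    gmono.monotoneOn (hmaps hx) (hmaps hy) (smono hx hy hxy)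
  have hg1 : 0 < g 1 := by
    rw [← hgσc]; exact gmono hσc0.le (mem_Ici.2 zero_le_one) hσc1
  have c1 : ContinuousOn (fun r => deriv g (σs r) * F0 r * r ^ 2) (Icc 0 1) := by fun_prop
  have c2 : ContinuousOn (fun r => deriv g (σs r) * w r * r ^ 2) (Icc 0 1) := by fun_prop
  have c3 : ContinuousOn (fun r => g (σs r) * r) (Icc 0 1) := hc.mul continuousOn_id
  have c4 : ContinuousOn (fun r => g (σs r) * r ^ 2) (Icc 0 1) :=
    hc.mul (continuousOn_id.pow 2)
  have i1 := c1.intervalIntegrable_of_Icc (μ := volume) zero_le_one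
  have i2 := c2.intervalIntegrable_of_Icc (μ := volume) zero_le_one
  have i3 := c3.intervalIntegrable_of_Icc (μ := volume) zero_le_one
  have i4 := c4.intervalIntegrable_of_Icc (μ := volume) zero_le_one
  have ftc := intervalIntegral.integral_eq_sub_of_hasDerivAt_of_le zero_le_one c4
    (f' := fun r => deriv g (σs r) * w r * r ^ 2 + 2 * (g (σs r) * r)) (fun r hr => by
      have hcc : r ∈ Ioc (0:ℝ) 1 := ⟨hr.1, hr.2.le⟩
      have hgg : HasDerivAt g (deriv g (σs r)) (σs r) :=
        (differentiableAt_of_deriv_ne_zero (hgp _ (snn r hcc)).ne').hasDerivAt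
      have h := (hgg.comp r (sd1 r hcc)).mul ((hasDerivAt_id r).pow 2)
      refine HasDerivAt.congr_deriv h ?_
      rw [wr r hr.1]
      simp
      ring) (i2.add (i3.const_mul 2))
  rw [intervalIntegral.integral_add i2 (i3.const_mul 2),
    intervalIntegral.integral_const_mul] at ftc
  simp only [s1, one_pow, mul_one, ne_eq, OfNat.ofNat_ne_zero, not_false_eq_true, zero_pow,
    mul_zero, sub_zero] at ftc
  have hle : (∫ r in (0:ℝ)..1, deriv g (σs r) * F0 r * r ^ 2)
      + (∫ r in (0:ℝ)..1, deriv g (σs r) * w r * r ^ 2) ≤ 0 := by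
    rw [← intervalIntegral.integral_add i1 i2]
    rw [← neg_nonneg, ← intervalIntegral.integral_neg]
    apply intervalIntegral.integral_nonneg zero_le_one
    intro r hr
    have h1 := hgp (σs r) (snn' r hr)
    have h2 := unp r hr
    have h3 : 0 ≤ deriv g (σs r) * r ^ 2 := by positivity
    have := mul_nonpos_of_nonneg_of_nonpos h3 h2
    linarith
  have hI : g 1 + (∫ r in (0:ℝ)..1, deriv g (σs r) * F0 r * r ^ 2)
        ≤ 2 * ∫ r in (0:ℝ)..1, g (σs r) * r := by linarith
  have h1s : g (σs 1) = g 1 := by rw [s1]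
  have h0neg : g (σs 0) ≤ 0 := by
    by_contra! hpos
    have : 0 < ∫ r in (0:ℝ)..1, g (σs r) * r ^ 2 := by
      refine intervalIntegral.integral_pos zero_lt_one c4 ?_ ⟨1, by simp, ?_⟩
      · intro r hr
        have := hmono (left_mem_Icc.2 zero_le_one) ⟨hr.1.le, hr.2⟩ hr.1.le
        simp only at this
        have : 0 ≤ g (σs r) := by linarith
        positivity
      · simpa [h1s] using hg1
    linarith
  obtain ⟨r0, hr0, hr0z⟩ := intermediate_value_Icc zero_le_one hc
    (show (0:ℝ) ∈ Icc (g (σs 0)) (g (σs 1)) from ⟨h0neg, by rw [h1s]; exact hg1.le⟩)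
  simp only at hr0z
  have hr01 : r0 < 1 := by
    refine lt_of_le_of_ne hr0.2 fun h => ?_
    rw [h, h1s] at hr0z
    linarith
  have hJ : 0 < ∫ r in (0:ℝ)..1, (g (σs r) * r ^ 2 - r0 * (g (σs r) * r)) := by
    refine intervalIntegral.integral_pos zero_lt_one (c4.sub (c3.const_smul r0)) ?_ ⟨1, by simp, ?_⟩
    · intro r hr
      have hrI : r ∈ Icc (0:ℝ) 1 := ⟨hr.1.le, hr.2⟩
      have key : 0 ≤ g (σs r) * (r - r0) := by
        rcases le_total r r0 with h | h
        · have := hmono hrI hr0 h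
          simp only at this
          exact mul_nonneg_of_nonpos_of_nonpos (by linarith) (by linarith)
        · have := hmono hr0 hrI h
          simp only at this
          exact mul_nonneg (by linarith) (by linarith)
      have := mul_nonneg key hr.1.le
      linarith
    · rw [h1s]; nlinarith
  rw [intervalIntegral.integral_sub i4 (i3.const_mul r0), hnorm,
    intervalIntegral.integral_const_mul] at hJ
  have hneg : (∫ r in (0:ℝ)..1, g (σs r) * r) < 0 := by
    by_contra! h
    have := mul_nonneg hr0.1 h
    linarith
  exact ⟨hI, by linarith, by linarith⟩
end
end

section
/- Under Assumptions (A1)–(A3), let l ≥ 2 be an integer, assume the function r ↦ g'(σ_s(r))F_l(r) is continuously differentiable on (0,1] and bounded together with its derivative near 0, and define for 0 < r ≤ 1: Ϝ¹_l(r) := √((l+1)/(2l+1))·[ −(d/dr)(g'(σ_s(r))F_l(r)) + (l/r)·g'(σ_s(r))F_l(r) ] and ṽ_l(r) := (r/(2l+3))·√((l+1)/(2l+1))·g'(σ_s(r))F_l(r) + (r^{−l−2}/(2l+3))·∫₀^r s^{l+3} Ϝ¹_l(s) ds. Then ṽ_l(1) = √((l+1)/(2l+1))·∫₀¹ g'(σ_s(r))F_l(r)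 r^{l+2} dr, and ṽ_l'(1) = −√((l+1)/(2l+1))·g'(1)σ_s'(1) − (l+2)·√((l+1)/(2l+1))·∫₀¹ g'(σ_s(r))F_l(r) r^{l+2} dr. -/
open Set Filter MeasureTheory

noncomputable section

/-- `Ϝ¹_l(r) = √((l+1)/(2l+1)) [ -(g'(σ_s)F_l)'(r) + (l/r) g'(σ_s(r))F_l(r) ]`. -/
def Fl1 (g σs F : ℝ → ℝ) (l : ℕ) (r : ℝ) : ℝ :=
  Real.sqrt (((l : ℝ) + 1) / (2 * (l : ℝ) + 1)) *
    (-(deriv (fun s => deriv g (σs s) * F s) r)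
      + ((l : ℝ) / r) * (deriv g (σs r) * F r))

/-- `ṽ_l(r) = (r/(2l+3)) √((l+1)/(2l+1)) g'(σ_s(r))F_l(r)
    + (r^{-l-2}/(2l+3)) ∫₀ʳ s^{l+3} Ϝ¹_l(s) ds`. -/
def vTilde (g σs F : ℝ → ℝ) (l : ℕ) (r : ℝ) : ℝ :=
  (r / (2 * (l : ℝ) + 3)) * Real.sqrt (((l : ℝ) + 1) / (2 * (l : ℝ) + 1)) *
      (deriv g (σs r) * F r)
    + (r ^ (-(l : ℤ) - 2) / (2 * (l : ℝ) + 3)) *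
        ∫ s in (0:ℝ)..r, s ^ (l + 3) * Fl1 g σs F l s

theorem aux_cont (ψ : ℝ → ℝ) (hc : ContinuousOn ψ (Ioc 0 1))
    (hb : ∃ ε > (0:ℝ), ∃ M : ℝ, ∀ r ∈ Ioo (0:ℝ) ε, |ψ r| ≤ M) (k : ℕ) :
    ContinuousOn (fun s => s ^ (k + 1) * ψ s) (Icc 0 1) := by
  intro x hx
  rcases eq_or_lt_of_le hx.1 with h0 | h0
  · subst h0
    obtain ⟨ε, hε, M, hM⟩ := hb
    have hlim : Tendsto (fun s : ℝ => |s ^ (k + 1)| * |M|) (nhdsWithin 0 (Icc 0 1)) (nhds 0) := by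
      have : Continuous (fun s : ℝ => |s ^ (k + 1)| * |M|) := by fun_prop
      have h := this.tendsto 0
      simp only [ne_eq, Nat.add_eq_zero_iff, one_ne_zero, and_false, not_false_eq_true, zero_pow,
        abs_zero, zero_mul] at h
      exact h.mono_left nhdsWithin_le_nhds
    unfold ContinuousWithinAt
    simp only [ne_eq, Nat.add_eq_zero_iff, one_ne_zero, and_false, not_false_eq_true, zero_pow,
      zero_mul]
    refine squeeze_zero_norm' ?_ hlim
    have h1 : Iio ε ∈ nhdsWithin (0:ℝ) (Icc 0 1) := mem_nhdsWithin_of_mem_nhds (Iio_mem_nhds hε)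
    filter_upwards [h1, self_mem_nhdsWithin] with s hs hs'
    rw [Real.norm_eq_abs, abs_mul]
    rcases eq_or_lt_of_le hs'.1 with h | h
    · subst h; simp
    · exact mul_le_mul_of_nonneg_left ((hM s ⟨h, hs⟩).trans (le_abs_self M)) (abs_nonneg _)
  · have h1 : ContinuousWithinAt ψ (Icc 0 1) x := by
      refine (hc x ⟨h0, hx.2⟩).mono_of_mem_nhdsWithin ?_
      filter_upwards [mem_nhdsWithin_of_mem_nhds (Ioi_mem_nhds h0), self_mem_nhdsWithin] with s a b
      exact ⟨a, b.2⟩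
    exact (by fun_prop : ContinuousWithinAt (fun s : ℝ => s ^ (k + 1)) (Icc 0 1) x).mul h1

theorem aux_int (φ φ' : ℝ → ℝ) (l : ℕ) (hd : ∀ r ∈ Ioc (0:ℝ) 1, HasDerivAt φ (φ' r) r)
    (h2 : ContinuousOn (fun s => s ^ (l + 2) * φ s) (Icc 0 1))
    (h3 : ContinuousOn (fun s => s ^ (l + 3) * φ s) (Icc 0 1))
    (h3' : ContinuousOn (fun s => s ^ (l + 3) * φ' s) (Icc 0 1))
    (c r : ℝ) (hr : r ∈ Ioc (0:ℝ) 1) :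
    ∫ s in (0:ℝ)..r, s ^ (l + 3) * (c * (-(φ' s) + ((l:ℝ) / s) * φ s))
      = c * (-(r ^ (l + 3) * φ r) + (2 * (l:ℝ) + 3) * ∫ s in (0:ℝ)..r, s ^ (l + 2) * φ s) := by
  have hsub : Icc (0:ℝ) r ⊆ Icc 0 1 := Icc_subset_Icc_right hr.2
  have i2 : IntervalIntegrable (fun s => s ^ (l + 2) * φ s) volume 0 r :=
    (h2.mono hsub).intervalIntegrable_of_Icc hr.1.le
  have i3 : IntervalIntegrable (fun s => s ^ (l + 3) * φ' s) volume 0 r :=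
    (h3'.mono hsub).intervalIntegrable_of_Icc hr.1.le
  have key : ∫ s in (0:ℝ)..r, (((l:ℝ) + 3) * (s ^ (l + 2) * φ s) + s ^ (l + 3) * φ' s)
      = r ^ (l + 3) * φ r - 0 ^ (l + 3) * φ 0 := by
    refine intervalIntegral.integral_eq_sub_of_hasDerivAt_of_le hr.1.le (h3.mono hsub) ?_
      ((i2.const_mul _).add i3)
    intro x hx
    have := (hasDerivAt_pow (l + 3) x).mul (hd x ⟨hx.1, hx.2.le.trans hr.2⟩)
    refine HasDerivAt.congr_deriv this ?_
    rw [show l + 3 - 1 = l + 2 from rfl]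
    push_cast
    ring
  rw [intervalIntegral.integral_add (i2.const_mul _) i3, intervalIntegral.integral_const_mul] at key
  have e : ∫ s in (0:ℝ)..r, s ^ (l + 3) * (c * (-(φ' s) + ((l:ℝ) / s) * φ s))
      = ∫ s in (0:ℝ)..r, (c * (l:ℝ)) * (s ^ (l + 2) * φ s) - c * (s ^ (l + 3) * φ' s) := by
    refine intervalIntegral.integral_congr fun s _ => ?_
    rcases eq_or_ne s 0 with h | h
    · subst h; simp
    · field_simp; ring
  rw [e, intervalIntegral.integral_sub (i2.const_mul _) (i3.const_mul _),
    intervalIntegral.integral_const_mul, intervalIntegral.integral_const_mul]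
  simp only [ne_eq, Nat.add_eq_zero_iff, OfNat.ofNat_ne_zero, and_false, not_false_eq_true,
    zero_pow, zero_mul, sub_zero] at key
  linear_combination (-c) * key

/-- Identities (3.42) and (3.44): the boundary values of `ṽ_l` at `r = 1` (the
derivative at `1` being the one-sided derivative within `(0,1]`). -/
theorem vTilde_boundary_values (f g σs F : ℝ → ℝ) (l : ℕ) (hl : 2 ≤ l)
    (hf : A1cond f) (hg : A2A3cond g) (hσ : SigmaS f σs) (hF : RadF f σs l F)
    (hφd : ∀ r ∈ Ioc (0:ℝ) 1,
      HasDerivAt (fun s => deriv g (σs s) * F s)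
        (deriv (fun s => deriv g (σs s) * F s) r) r)
    (hφdc : ContinuousOn (deriv (fun s => deriv g (σs s) * F s)) (Ioc 0 1))
    (hbd : ∃ ε > (0:ℝ), ∃ M : ℝ, ∀ r ∈ Ioo (0:ℝ) ε,
      |deriv g (σs r) * F r| ≤ M ∧ |deriv (fun s => deriv g (σs s) * F s) r| ≤ M) :
    vTilde g σs F l 1
        = Real.sqrt (((l : ℝ) + 1) / (2 * (l : ℝ) + 1)) *
            ∫ r in (0:ℝ)..1, deriv g (σs r) * F r * r ^ (l + 2) ∧
    HasDerivWithinAt (vTilde g σs F l)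
      (-Real.sqrt (((l : ℝ) + 1) / (2 * (l : ℝ) + 1)) * deriv g 1 * deriv σs 1
        - ((l : ℝ) + 2) * Real.sqrt (((l : ℝ) + 1) / (2 * (l : ℝ) + 1)) *
            ∫ r in (0:ℝ)..1, deriv g (σs r) * F r * r ^ (l + 2))
      (Ioc 0 1) 1 := by
  obtain ⟨ε, hε, M, hM⟩ := hbd
  set φ : ℝ → ℝ := fun s => deriv g (σs s) * F s with hφ
  have hφc : ContinuousOn φ (Ioc 0 1) := fun r hr => (hφd r hr).continuousAt.continuousWithinAt
  have b1 : ∃ ε > (0:ℝ), ∃ M : ℝ, ∀ r ∈ Ioo (0:ℝ) ε, |φ r| ≤ M :=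
    ⟨ε, hε, M, fun r hr => (hM r hr).1⟩
  have b2 : ∃ ε > (0:ℝ), ∃ M : ℝ, ∀ r ∈ Ioo (0:ℝ) ε, |deriv φ r| ≤ M :=
    ⟨ε, hε, M, fun r hr => (hM r hr).2⟩
  have h2 := aux_cont φ hφc b1 (l + 1)
  have h3 := aux_cont φ hφc b1 (l + 2)
  have h3' := aux_cont (deriv φ) hφdc b2 (l + 2)
  set c := Real.sqrt (((l : ℝ) + 1) / (2 * (l : ℝ) + 1)) with hc
  have hI : ∫ r in (0:ℝ)..1, deriv g (σs r) * F r * r ^ (l + 2)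
      = ∫ s in (0:ℝ)..1, s ^ (l + 2) * φ s :=
    intervalIntegral.integral_congr fun s _ => mul_comm _ _
  rw [hI]
  have hl3 : (2 * (l:ℝ) + 3) ≠ 0 := by positivity
  have hv : ∀ r ∈ Ioc (0:ℝ) 1, vTilde g σs F l r
      = c * (r ^ (-(l : ℤ) - 2) * ∫ s in (0:ℝ)..r, s ^ (l + 2) * φ s) := by
    intro r hr
    have := aux_int φ (deriv φ) l hφd h2 h3 h3' c r hr
    have e : vTilde g σs F l r = (r / (2 * (l : ℝ) + 3)) * c * φ r
      + (r ^ (-(l : ℤ) - 2) / (2 * (l : ℝ) + 3)) *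
        ∫ s in (0:ℝ)..r, s ^ (l + 3) * (c * (-(deriv φ s) + ((l:ℝ) / s) * φ s)) := rfl
    rw [e, this]
    have hp : r ^ (-(l : ℤ) - 2) * r ^ (l + 3) = r := by
      rw [← zpow_natCast r (l + 3), ← zpow_add₀ hr.1.ne']
      have : -(l:ℤ) - 2 + ((l + 3 : ℕ) : ℤ) = 1 := by push_cast; ring
      rw [this, zpow_one]
    field_simp
    linear_combination (- c * φ r) * hp
  have m1 : (1:ℝ) ∈ Ioc (0:ℝ) 1 := ⟨one_pos, le_rfl⟩
  refine ⟨by rw [hv 1 m1]; simp, ?_⟩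
  have hmem : Icc (0:ℝ) 1 ∈ nhdsWithin (1:ℝ) (Iic 1) := Icc_mem_nhdsLE one_pos
  have hFTC : HasDerivWithinAt (fun r => ∫ s in (0:ℝ)..r, s ^ (l + 2) * φ s)
      ((1:ℝ) ^ (l + 2) * φ 1) (Iic 1) 1 :=
    intervalIntegral.integral_hasDerivWithinAt_right
      (h2.intervalIntegrable_of_Icc zero_le_one)
      ⟨Icc 0 1, hmem, h2.aestronglyMeasurable measurableSet_Icc⟩
      ((h2 1 ⟨zero_le_one, le_rfl⟩).mono_of_mem_nhdsWithin hmem)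
  have hz : HasDerivAt (fun r : ℝ => r ^ (-(l : ℤ) - 2))
      (((-(l : ℤ) - 2 : ℤ) : ℝ) * 1 ^ (-(l : ℤ) - 2 - 1)) 1 :=
    hasDerivAt_zpow _ _ (Or.inl one_ne_zero)
  have hD := ((hz.hasDerivWithinAt.mul (hFTC.mono (fun x hx => hx.2 : Ioc (0:ℝ) 1 ⊆ Iic 1))).const_mul c)
  have hφ1 : φ 1 = - (deriv g 1 * deriv σs 1) := by
    obtain ⟨-, -, -, -, -, -, -, -, hs1⟩ := hσ
    obtain ⟨-, -, -, -, -, -, -, hF1⟩ := hF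
    simp only [hφ, hs1, hF1]; ring
  refine (hD.congr_of_mem (fun r hr => ?_) m1).congr_deriv ?_
  · rw [hv r hr]; rfl
  · rw [hφ1]
    push_cast
    simp only [one_zpow, one_pow]
    ring
end
end

section
/- Under Assumptions (A1)–(A3), let l ≥ 2 be an integer, assume the function r ↦ g'(σ_s(r))F_l(r) is continuously differentiable on (0,1] and bounded together with its derivative near 0, and define for 0 < r ≤ 1: Ϝ²_l(r) := √(l/(2l+1))·[ (d/dr)(g'(σ_s(r))F_l(r)) + ((l+1)/r)·g'(σ_s(r))F_l(r) ] and w̃_l(r) := (r/(2l−1))·√(l/(2l+1))·g'(σ_s(r))F_l(r) + (r^{l−1}/(2l−1))·∫_r^1 s^{−l+2} Ϝ²_l(s) ds. Then w̃_l(1) = −√(l/(2l+1))·(g'(1)σ_s'(1))/(2l−1), and w̃_l'(1) = √(l/(2l+1))·(l/(2l−1))·g'(1)σ_s'(1). -/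
open Set Filter MeasureTheory

noncomputable section

/-- `Ϝ²_l(r) = √(l/(2l+1)) [ (g'(σ_s)F_l)'(r) + ((l+1)/r) g'(σ_s(r))F_l(r) ]`. -/
def Fl2 (g σs F : ℝ → ℝ) (l : ℕ) (r : ℝ) : ℝ :=
  Real.sqrt ((l : ℝ) / (2 * (l : ℝ) + 1)) *
    (deriv (fun s => deriv g (σs s) * F s) r
      + (((l : ℝ) + 1) / r) * (deriv g (σs r) * F r))

/-- `w̃_l(r) = (r/(2l-1)) √(l/(2l+1)) g'(σ_s(r))F_l(r)
    + (r^{l-1}/(2l-1)) ∫ᵣ¹ s^{-l+2} Ϝ²_l(s) ds`. -/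
def wTilde (g σs F : ℝ → ℝ) (l : ℕ) (r : ℝ) : ℝ :=
  (r / (2 * (l : ℝ) - 1)) * Real.sqrt ((l : ℝ) / (2 * (l : ℝ) + 1)) *
      (deriv g (σs r) * F r)
    + (r ^ ((l : ℤ) - 1) / (2 * (l : ℝ) - 1)) *
        ∫ s in r..(1:ℝ), s ^ (2 - (l : ℤ)) * Fl2 g σs F l s

/-- Identities (3.43) and (3.45): the boundary values of `w̃_l` at `r = 1` (the
derivative at `1` being the one-sided derivative within `(0,1]`). -/
theorem wTilde_boundary_values (f g σs F : ℝ → ℝ) (l : ℕ) (hl : 2 ≤ l)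
    (hf : A1cond f) (hg : A2A3cond g) (hσ : SigmaS f σs) (hF : RadF f σs l F)
    (hφd : ∀ r ∈ Ioc (0:ℝ) 1,
      HasDerivAt (fun s => deriv g (σs s) * F s)
        (deriv (fun s => deriv g (σs s) * F s) r) r)
    (hφdc : ContinuousOn (deriv (fun s => deriv g (σs s) * F s)) (Ioc 0 1))
    (hbd : ∃ ε > (0:ℝ), ∃ M : ℝ, ∀ r ∈ Ioo (0:ℝ) ε,
      |deriv g (σs r) * F r| ≤ M ∧ |deriv (fun s => deriv g (σs s) * F s) r| ≤ M) :
    wTilde g σs F l 1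
        = -Real.sqrt ((l : ℝ) / (2 * (l : ℝ) + 1)) *
            (deriv g 1 * deriv σs 1) / (2 * (l : ℝ) - 1) ∧
    HasDerivWithinAt (wTilde g σs F l)
      (Real.sqrt ((l : ℝ) / (2 * (l : ℝ) + 1)) * ((l : ℝ) / (2 * (l : ℝ) - 1)) *
        (deriv g 1 * deriv σs 1))
      (Ioc 0 1) 1 := by
  have h1 : σs 1 = 1 := hσ.2.2.2.2.2.2.2.2
  have hF1 : F 1 = -deriv σs 1 := hF.2.2.2.2.2.2.2
  have hl2 : (2:ℝ) ≤ l := by exact_mod_cast hl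
  have hne : (2 * (l:ℝ) - 1) ≠ 0 := by linarith
  have hm : (1:ℝ) ∈ Ioc (0:ℝ) 1 := by simp
  constructor
  · simp only [wTilde, intervalIntegral.integral_same, h1, hF1]
    ring
  · have hpos : ∀ r ∈ Ioc (0:ℝ) 1, r ≠ 0 := fun r hr => hr.1.ne'
    have hφc : ContinuousOn (fun s => deriv g (σs s) * F s) (Ioc 0 1) :=
      fun r hr => (hφd r hr).continuousAt.continuousWithinAt
    have hFc : ContinuousOn (fun s => Fl2 g σs F l s) (Ioc 0 1) := by
      unfold Fl2
      exact continuousOn_const.mul (hφdc.add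
        ((continuousOn_const.div continuousOn_id hpos).mul hφc))
    have hc : ContinuousOn (fun s : ℝ => s ^ (2 - (l : ℤ)) * Fl2 g σs F l s) (Ioc 0 1) :=
      (continuousOn_id.zpow₀ _ (fun r hr => Or.inl (hpos r hr))).mul hFc
    have heq : nhdsWithin (1:ℝ) (Ioc 0 1) = nhdsWithin 1 (Iic 1) :=
      nhdsWithin_Ioc_eq_nhdsLE one_pos
    have hcw : ContinuousWithinAt (fun s : ℝ => s ^ (2 - (l : ℤ)) * Fl2 g σs F l s)
        (Iic 1) 1 := by
      have := hc 1 hm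
      rwa [ContinuousWithinAt, heq] at this
    have hsm : StronglyMeasurableAtFilter (fun s : ℝ => s ^ (2 - (l : ℤ)) * Fl2 g σs F l s)
        (nhdsWithin 1 (Iic 1)) volume := by
      rw [← heq]
      exact ⟨Ioc 0 1, self_mem_nhdsWithin, hc.aestronglyMeasurable measurableSet_Ioc⟩
    have hI : HasDerivWithinAt
        (fun r : ℝ => ∫ s in r..(1:ℝ), s ^ (2 - (l : ℤ)) * Fl2 g σs F l s)
        (-((1:ℝ) ^ (2 - (l : ℤ)) * Fl2 g σs F l 1)) (Iic 1) 1 :=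
      intervalIntegral.integral_hasDerivWithinAt_left (by simp) hsm hcw
    have hI' := hI.mono (show Ioc (0:ℝ) 1 ⊆ Iic 1 from fun r hr => hr.2)
    have hp : HasDerivWithinAt (fun r : ℝ => r ^ ((l : ℤ) - 1) / (2 * (l : ℝ) - 1))
        ((((l : ℤ) - 1 : ℤ) : ℝ) * (1:ℝ) ^ ((l : ℤ) - 1 - 1) / (2 * (l : ℝ) - 1))
        (Ioc 0 1) 1 :=
      ((hasDerivAt_zpow _ (1:ℝ) (Or.inl one_ne_zero)).div_const _).hasDerivWithinAt
    have hlin : HasDerivWithinAt (fun r : ℝ => (r / (2 * (l : ℝ) - 1)) *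
        Real.sqrt ((l : ℝ) / (2 * (l : ℝ) + 1)))
        ((1 / (2 * (l : ℝ) - 1)) * Real.sqrt ((l : ℝ) / (2 * (l : ℝ) + 1))) (Ioc 0 1) 1 :=
      (((hasDerivAt_id (1:ℝ)).div_const _).mul_const _).hasDerivWithinAt
    have hall := (hlin.mul (hφd 1 hm).hasDerivWithinAt).add (hp.mul hI')
    refine HasDerivWithinAt.congr_deriv (f := wTilde g σs F l) hall ?_
    simp only [intervalIntegral.integral_same, Fl2, h1, hF1, one_zpow]
    field_simp
    ring
end
end
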